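/- arXiv:1509.05752 — 2 statements merged into one kernel-verified Lean document; each statement's English description precedes it below -/
import Mathlib

section
/- Fix α, β ∈ (0, ∞). Let B_n be the number of boxes on the second main diagonal of a random α/β-staircase tableau of size n that contain β. Then for every integer r ≥ 1 the r-th factorial moment satisfies E_{n,α,β}[B_n(B_n−1)⋯(B_n−r+1)] → (1/2)^r as n → ∞, and consequently B_n converges in distribution to a Poisson random variable with parameter 1/2: for every integer k ≥ 0, ℙ_{n,α,β}(B_n = k) → e^{−1/2} (1/2)^k / k! as n → ∞. -/
open scoped BigOperators

/-- A symbol in an α/β-staircase tableau: empty, α, or β. -/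
inductive StairSymb : Type
  | empty : StairSymb
  | alpha : StairSymb
  | beta  : StairSymb
  deriving DecidableEq

/-- `S` is an α/β-staircase tableau of size `n` (1-based indexing; boxes are the
pairs `(i,j)` with `1 ≤ i`, `1 ≤ j`, `i + j ≤ n + 1`; outside the boxes `S` is empty). -/
def IsStaircase (n : ℕ) (S : ℕ → ℕ → StairSymb) : Prop :=
  (∀ i j, ¬(1 ≤ i ∧ 1 ≤ j ∧ i + j ≤ n + 1) → S i j = StairSymb.empty) ∧
  (∀ i i' j, 1 ≤ i → i < i' → 1 ≤ j → i' + j ≤ n + 1 →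
    S i' j = StairSymb.alpha → S i j = StairSymb.empty) ∧
  (∀ i j j', 1 ≤ i → 1 ≤ j → j < j' → i + j' ≤ n + 1 →
    S i j' = StairSymb.beta → S i j = StairSymb.empty) ∧
  (∀ i j, 1 ≤ i → 1 ≤ j → i + j = n + 1 → S i j ≠ StairSymb.empty)

/-- The weight `wt(S) = α^{N_α(S)} β^{N_β(S)}` of a tableau. -/
noncomputable def stairWt (α β : ℝ) (S : ℕ → ℕ → StairSymb) : ℝ :=
  α ^ Set.ncard {p : ℕ × ℕ | S p.1 p.2 = StairSymb.alpha} *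
  β ^ Set.ncard {p : ℕ × ℕ | S p.1 p.2 = StairSymb.beta}

/-- The partition function `Z_n(α,β)`, the total weight of all tableaux of size `n`. -/
noncomputable def stairZ (n : ℕ) (α β : ℝ) : ℝ :=
  ∑ᶠ S ∈ {S : ℕ → ℕ → StairSymb | IsStaircase n S}, stairWt α β S

/-- The probability `ℙ_{n,α,β}(E)` of an event `E` (a set of tableaux of size `n`). -/
noncomputable def stairP (n : ℕ) (α β : ℝ) (E : (ℕ → ℕ → StairSymb) → Prop) : ℝ :=
  (∑ᶠ S ∈ {S : ℕ → ℕ → StairSymb | IsStaircase n S ∧ E S}, stairWt α β S) / stairZ n α β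

/-- The expectation `E_{n,α,β}[f]` of a real function of the random tableau. -/
noncomputable def stairE (n : ℕ) (α β : ℝ) (f : (ℕ → ℕ → StairSymb) → ℝ) : ℝ :=
  (∑ᶠ S ∈ {S : ℕ → ℕ → StairSymb | IsStaircase n S}, f S * stairWt α β S) / stairZ n α β

namespace StaircaseTableau

open StairSymb Finset

/-- The first column of an extended tableau: nonempty exactly on the rows in `Y`,
with the symbol `t` in the topmost of these and `beta` in all the others. -/
def column (Y : Finset ℕ) (t : StairSymb) (i : ℕ) : StairSymb :=
  if i ∈ Y then (if ∀ k ∈ Y, i ≤ k then t else beta) else empty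

/-- Shift `S` one column to the right and insert `c` as the first column. -/
def consColumn (c : ℕ → StairSymb) (S : ℕ → ℕ → StairSymb) : ℕ → ℕ → StairSymb
  | _, 0 => empty
  | i, 1 => c i
  | i, j + 2 => S i (j + 1)

/-- Forget the first column. -/
def tailColumns (S : ℕ → ℕ → StairSymb) : ℕ → ℕ → StairSymb
  | _, 0 => empty
  | i, j + 1 => S i (j + 2)

open Classical in
/-- The rows of a tableau of size `n` that contain no `beta`. -/
noncomputable def freeRows (n : ℕ) (S : ℕ → ℕ → StairSymb) : Finset ℕ :=
  (Icc 1 n).filter fun i => ∀ j, S i j ≠ beta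

/-- The number of `beta`s on the second main diagonal. -/
def secondBetas (n : ℕ) (S : ℕ → ℕ → StairSymb) : ℕ :=
  ((Icc 1 (n - 1)).filter (fun j => S (n - j) j = beta)).card

/-- The extension of a tableau of size `n` to size `n + 1` by a first column whose
nonempty boxes lie in the rows `X` and `n + 1`. -/
def extend (n : ℕ) (S : ℕ → ℕ → StairSymb) (X : Finset ℕ) (t : StairSymb) :
    ℕ → ℕ → StairSymb :=
  consColumn (column (insert (n + 1) X) t) S

lemma mem_freeRows {n : ℕ} {S : ℕ → ℕ → StairSymb} {i : ℕ} :
    i ∈ freeRows n S ↔ (1 ≤ i ∧ i ≤ n) ∧ ∀ j, S i j ≠ beta := by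
  simp [freeRows]

lemma column_eq_empty {Y : Finset ℕ} {t : StairSymb} (ht : t ≠ empty) {i : ℕ} :
    column Y t i = empty ↔ i ∉ Y := by
  unfold column; split_ifs <;> simp_all

lemma column_eq_alpha {Y : Finset ℕ} {t : StairSymb} {i : ℕ} :
    column Y t i = alpha ↔ i ∈ Y ∧ (∀ k ∈ Y, i ≤ k) ∧ t = alpha := by
  unfold column; split_ifs <;> simp_all

lemma column_eq_beta {Y : Finset ℕ} {t : StairSymb} {i : ℕ} :
    column Y t i = beta ↔ i ∈ Y ∧ ((∀ k ∈ Y, i ≤ k) → t = beta) := by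
  unfold column; split_ifs <;> simp_all

lemma tailColumns_consColumn {n : ℕ} {S : ℕ → ℕ → StairSymb} (hS : IsStaircase n S)
    (c : ℕ → StairSymb) : tailColumns (consColumn c S) = S := by
  funext i j
  cases j with
  | zero => exact (hS.1 i 0 (by omega)).symm
  | succ j => rfl

lemma isStaircase_extend {n : ℕ} {S : ℕ → ℕ → StairSymb} {X : Finset ℕ} {t : StairSymb}
    (hS : IsStaircase n S) (hX : X ⊆ freeRows n S) (ht : t ≠ empty) :
    IsStaircase (n + 1) (extend n S X t) := by
  have hX' : ∀ i ∈ X, (1 ≤ i ∧ i ≤ n) ∧ ∀ j, S i j ≠ beta := fun i hi => mem_freeRows.1 (hX hi)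
  obtain ⟨h1, h2, h3, h4⟩ := hS
  refine ⟨?_, ?_, ?_, ?_⟩
  · intro i j hij
    match j with
    | 0 => rfl
    | 1 =>
      refine (column_eq_empty ht).2 fun hi => ?_
      rcases mem_insert.1 hi with rfl | hi
      · omega
      · have := hX' i hi; omega
    | j + 2 => exact h1 i (j + 1) (by omega)
  · intro i i' j hi hii' hj hij h
    match j with
    | 0 => rfl
    | 1 =>
      obtain ⟨-, h, -⟩ := column_eq_alpha.1 h
      exact (column_eq_empty ht).2 fun hi => absurd (h i hi) (by omega)
    | j + 2 => exact h2 i i' (j + 1) hi hii' (by omega) (by omega) h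
  · intro i j j' hi hj hjj' hij h
    match j, j' with
    | 0, _ => rfl
    | 1, 0 => omega
    | 1, 1 => omega
    | 1, j' + 2 =>
      refine (column_eq_empty ht).2 fun hi => ?_
      rcases mem_insert.1 hi with rfl | hi
      · omega
      · exact (hX' i hi).2 _ h
    | j + 2, 0 => omega
    | j + 2, 1 => omega
    | j + 2, j' + 2 => exact h3 i (j + 1) (j' + 1) hi (by omega) (by omega) (by omega) h
  · intro i j hi hj hij
    match j with
    | 0 => omega
    | 1 =>
      obtain rfl : i = n + 1 := by omega
      exact fun h => (column_eq_empty ht).1 h (mem_insert_self _ _)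
    | j + 2 => exact h4 i (j + 1) hi (by omega) (by omega)

lemma exists_eq_extend {n : ℕ} {S' : ℕ → ℕ → StairSymb} (hS : IsStaircase (n + 1) S') :
    ∃ S X t, IsStaircase n S ∧ X ⊆ freeRows n S ∧ (t = alpha ∨ t = beta) ∧
      S' = extend n S X t := by
  obtain ⟨h1, h2, h3, h4⟩ := hS
  set X := (Icc 1 n).filter (fun i => S' i 1 ≠ empty) with hXdef
  have hlast : S' (n + 1) 1 ≠ empty := h4 _ _ (by omega) le_rfl (by omega)
  have hY : ∀ i, i ∈ insert (n + 1) X ↔ S' i 1 ≠ empty := by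
    intro i
    simp only [hXdef, mem_insert, mem_filter, mem_Icc]
    constructor
    · rintro (rfl | h)
      · exact hlast
      · exact h.2
    · intro h
      by_contra hc
      exact h (h1 i 1 (by by_contra hb; exact hc (by
        by_cases hin : i = n + 1
        · exact Or.inl hin
        · exact Or.inr ⟨by omega, h⟩)))
  have hne : (insert (n + 1) X).Nonempty := ⟨n + 1, mem_insert_self _ _⟩
  set m := (insert (n + 1) X).min' hne with hm
  have hmY : m ∈ insert (n + 1) X := min'_mem _ _
  have hmin : ∀ k ∈ insert (n + 1) X, m ≤ k := fun k hk => min'_le _ _ hk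
  have htail : ∀ i j, 1 ≤ j → tailColumns S' i j = S' i (j + 1) := by
    intro i j hj
    obtain ⟨j, rfl⟩ := Nat.exists_eq_add_of_le' hj
    rfl
  refine ⟨tailColumns S', X, S' m 1, ⟨?_, ?_, ?_, ?_⟩, ?_, ?_, ?_⟩
  · intro i j hij
    match j with
    | 0 => rfl
    | j + 1 => exact h1 i (j + 2) (by omega)
  · intro i i' j hi hii' hj hij h
    rw [htail _ _ hj] at h ⊢
    exact h2 i i' (j + 1) hi hii' (by omega) (by omega) h
  · intro i j j' hi hj hjj' hij h
    rw [htail _ _ hj]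
    rw [htail _ _ (by omega)] at h
    exact h3 i (j + 1) (j' + 1) hi (by omega) (by omega) (by omega) h
  · intro i j hi hj hij
    rw [htail _ _ hj]
    exact h4 i (j + 1) hi (by omega) (by omega)
  · intro i hi
    simp only [hXdef, mem_filter, mem_Icc] at hi
    refine mem_freeRows.2 ⟨hi.1, fun j hj => ?_⟩
    match j with
    | 0 => exact absurd hj (by simp [tailColumns])
    | j + 1 =>
      change S' i (j + 2) = beta at hj
      by_cases hb : i + (j + 2) ≤ n + 2
      · exact hi.2 (h3 i 1 (j + 2) hi.1.1 le_rfl (by omega) hb hj)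
      · rw [h1 i (j + 2) (by omega)] at hj
        cases hj
  · have := (hY m).1 hmY
    generalize S' m 1 = s at this
    cases s
    · exact absurd rfl this
    · exact Or.inl rfl
    · exact Or.inr rfl
  · funext i j
    match j with
    | 0 => exact h1 i 0 (by omega)
    | 1 =>
      change S' i 1 = column _ _ i
      unfold column
      split_ifs with hi hle
      · rw [le_antisymm (hle m hmY) (hmin i hi)]
      · have hmi : m < i := lt_of_not_ge fun h => hle fun k hk => h.trans (hmin k hk)
        have hine := (hY i).1 hi
        cases h : S' i 1
        · exact absurd h hine
        · have hib : i + 1 ≤ n + 1 + 1 := by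
            by_contra hb
            exact hine (h1 i 1 (by omega))
          refine absurd (h2 m i 1 ?_ hmi le_rfl hib h) ((hY m).1 hmY)
          by_contra hb
          exact (hY m).1 hmY (h1 m 1 (by omega))
        · rfl
      · by_contra h
        exact hi ((hY i).2 h)
    | j + 2 => rfl

lemma column_injective {n : ℕ} {X X' : Finset ℕ} {t t' : StairSymb} (hX : n + 1 ∉ X)
    (hX' : n + 1 ∉ X') (ht : t ≠ empty) (ht' : t' ≠ empty)
    (h : column (insert (n + 1) X) t = column (insert (n + 1) X') t') : X = X' ∧ t = t' := by
  have hY : insert (n + 1) X = insert (n + 1) X' := by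
    ext i
    have := (column_eq_empty (Y := insert (n + 1) X) ht (i := i)).symm.trans
      ((by rw [h]) : _ ↔ column (insert (n + 1) X') t' i = empty)
    exact not_iff_not.1 (this.trans (column_eq_empty ht'))
  have hXX : X = X' := by
    rw [← erase_insert hX, hY, erase_insert hX']
  subst hXX
  refine ⟨rfl, ?_⟩
  have hne : (insert (n + 1) X).Nonempty := ⟨n + 1, mem_insert_self _ _⟩
  have hm := congrFun h ((insert (n + 1) X).min' hne)
  have h1 := (insert (n + 1) X).min'_mem hne
  have h2 : ∀ k ∈ insert (n + 1) X, (insert (n + 1) X).min' hne ≤ k := fun k hk => min'_le _ _ hk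
  unfold column at hm
  rwa [if_pos h1, if_pos h2, if_pos h1, if_pos h2] at hm

lemma notMem_of_subset_freeRows {n : ℕ} {S : ℕ → ℕ → StairSymb} {X : Finset ℕ}
    (hX : X ⊆ freeRows n S) : n + 1 ∉ X := fun h => by
  have := (mem_freeRows.1 (hX h)).1
  omega

lemma extend_injective {n : ℕ} {S S' : ℕ → ℕ → StairSymb} {X X' : Finset ℕ} {t t' : StairSymb}
    (hS : IsStaircase n S) (hS' : IsStaircase n S') (hX : X ⊆ freeRows n S)
    (hX' : X' ⊆ freeRows n S') (ht : t ≠ empty) (ht' : t' ≠ empty)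
    (h : extend n S X t = extend n S' X' t') : S = S' ∧ X = X' ∧ t = t' := by
  refine ⟨?_, column_injective (notMem_of_subset_freeRows hX) (notMem_of_subset_freeRows hX')
    ht ht' (funext fun i => congrFun (congrFun h i) 1)⟩
  rw [← tailColumns_consColumn hS (column (insert (n + 1) X) t),
    ← tailColumns_consColumn hS' (column (insert (n + 1) X') t')]
  exact congrArg tailColumns h

lemma isStaircase_zero {S : ℕ → ℕ → StairSymb} :
    IsStaircase 0 S ↔ S = fun _ _ => empty := by
  constructor
  · intro h
    funext i j
    exact h.1 i j (by omega)
  · rintro rfl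
    exact ⟨fun _ _ _ => rfl, fun _ _ _ _ _ _ _ _ => rfl, fun _ _ _ _ _ _ _ _ => rfl,
      fun i j _ _ _ => by omega⟩

open Classical in
/-- The finite set of all tableaux of size `n`. -/
noncomputable def tableaux : ℕ → Finset (ℕ → ℕ → StairSymb)
  | 0 => {fun _ _ => empty}
  | n + 1 => ((tableaux n).sigma fun S => (freeRows n S).powerset ×ˢ {alpha, beta}).image
      fun p => extend n p.1 p.2.1 p.2.2

lemma mem_tableaux {n : ℕ} {S : ℕ → ℕ → StairSymb} : S ∈ tableaux n ↔ IsStaircase n S := by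
  induction n generalizing S with
  | zero => rw [isStaircase_zero, tableaux, mem_singleton]
  | succ n ih =>
    simp only [tableaux, mem_image, mem_sigma, mem_product, mem_powerset, mem_insert,
      mem_singleton, ih]
    constructor
    · rintro ⟨⟨S, X, t⟩, ⟨hS, hX, ht⟩, rfl⟩
      exact isStaircase_extend hS hX (by rcases ht with rfl | rfl <;> simp_all)
    · intro h
      obtain ⟨S, X, t, hS, hX, ht, rfl⟩ := exists_eq_extend h
      exact ⟨⟨S, X, t⟩, ⟨hS, hX, ht⟩, rfl⟩

open Classical in
lemma sum_tableaux_succ {M : Type*} [AddCommMonoid M] (n : ℕ) (H : (ℕ → ℕ → StairSymb) → M) :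
    ∑ S ∈ tableaux (n + 1), H S = ∑ S ∈ tableaux n, ∑ X ∈ (freeRows n S).powerset,
      (H (extend n S X alpha) + H (extend n S X beta)) := by
  rw [tableaux, sum_image, sum_sigma]
  · refine sum_congr rfl fun S _ => ?_
    rw [sum_product]
    refine sum_congr rfl fun X _ => ?_
    rw [sum_pair (by simp)]
  · rintro ⟨S, X, t⟩ h ⟨S', X', t'⟩ h' heq
    simp only [coe_sigma, Set.mem_sigma_iff, mem_coe, mem_tableaux, mem_product, mem_powerset,
      mem_insert, mem_singleton] at h h'
    obtain ⟨rfl, rfl, rfl⟩ := extend_injective h.1 h'.1 h.2.1 h'.2.1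
      (by rcases h.2.2 with rfl | rfl <;> simp) (by rcases h'.2.2 with rfl | rfl <;> simp) heq
    rfl

lemma finite_setOf_eq {n : ℕ} {S : ℕ → ℕ → StairSymb} (hS : IsStaircase n S)
    {s : StairSymb} (hs : s ≠ empty) : {p : ℕ × ℕ | S p.1 p.2 = s}.Finite := by
  refine (Icc 1 (n + 1) ×ˢ Icc 1 (n + 1)).finite_toSet.subset fun p hp => ?_
  have hp : S p.1 p.2 = s := hp
  by_contra h
  rw [hS.1 p.1 p.2 (fun hb => h (mem_coe.2 (mem_product.2
    ⟨mem_Icc.2 (by omega), mem_Icc.2 (by omega)⟩)))] at hp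
  exact hs hp.symm

lemma ncard_consColumn {n : ℕ} {S : ℕ → ℕ → StairSymb} (hS : IsStaircase n S)
    {s : StairSymb} (hs : s ≠ empty) {c : ℕ → StairSymb} {Y : Finset ℕ}
    (hc : ∀ i, c i = s ↔ i ∈ Y) :
    {p : ℕ × ℕ | consColumn c S p.1 p.2 = s}.ncard =
      {p : ℕ × ℕ | S p.1 p.2 = s}.ncard + Y.card := by
  have hset : {p : ℕ × ℕ | consColumn c S p.1 p.2 = s} =
      (fun p : ℕ × ℕ => (p.1, p.2 + 1)) '' {p : ℕ × ℕ | S p.1 p.2 = s} ∪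
        (fun i : ℕ => (i, 1)) '' (Y : Set ℕ) := by
    ext ⟨i, j⟩
    simp only [Set.mem_ofPred_eq, Set.mem_union, Set.mem_image, Prod.exists, Prod.mk.injEq, mem_coe]
    match j with
    | 0 => simp [consColumn, hs.symm]
    | 1 =>
      change c i = s ↔ _
      rw [hc]
      constructor
      · exact fun h => Or.inr ⟨i, h, rfl, rfl⟩
      · rintro (⟨a, b, h, rfl, hb⟩ | ⟨a, h, rfl, -⟩)
        · rw [hS.1 _ _ (by omega)] at h
          exact absurd h.symm hs
        · exact h
    | j + 2 =>
      change S i (j + 1) = s ↔ _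
      constructor
      · exact fun h => Or.inl ⟨i, j + 1, h, rfl, rfl⟩
      · rintro (⟨a, b, h, rfl, hb⟩ | ⟨a, h, rfl, hb⟩)
        · rwa [show j + 1 = b by omega]
        · omega
  rw [hset, Set.ncard_union_eq _ ((finite_setOf_eq hS hs).image _) (Y.finite_toSet.image _),
    Set.ncard_image_of_injective _ (fun p q h => by
      simp only [Prod.mk.injEq, Nat.add_right_cancel_iff] at h
      exact Prod.ext h.1 h.2),
    Set.ncard_image_of_injective _ (fun p q h => by
      simp only [Prod.mk.injEq] at h
      exact h.1), Set.ncard_coe_finset]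
  rw [Set.disjoint_left]
  rintro ⟨i, j⟩ ⟨⟨a, b⟩, h, hab⟩ ⟨i', -, hi'⟩
  simp only [Prod.mk.injEq] at hab hi'
  have h : S a b = s := h
  rw [hS.1 _ _ (by omega)] at h
  exact hs h.symm

lemma stairWt_extend_beta (α β : ℝ) {n : ℕ} {S : ℕ → ℕ → StairSymb} (hS : IsStaircase n S)
    {X : Finset ℕ} (hX : X ⊆ freeRows n S) :
    stairWt α β (extend n S X beta) = stairWt α β S * (β * β ^ X.card) := by
  unfold stairWt extend
  rw [ncard_consColumn hS (by simp) (Y := ∅) (by simp [column_eq_alpha]),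
    ncard_consColumn hS (by simp) (Y := insert (n + 1) X) (by simp [column_eq_beta]),
    card_insert_of_notMem (notMem_of_subset_freeRows hX), card_empty]
  ring

lemma exists_isLeast (n : ℕ) (X : Finset ℕ) :
    ∃ m ∈ insert (n + 1) X, ∀ k ∈ insert (n + 1) X, m ≤ k :=
  have hne : (insert (n + 1) X).Nonempty := ⟨n + 1, mem_insert_self _ _⟩
  ⟨_, min'_mem _ hne, fun k hk => min'_le _ k hk⟩

lemma column_alpha_eq_alpha_iff {Y : Finset ℕ} {m : ℕ} (hm : m ∈ Y) (hmin : ∀ k ∈ Y, m ≤ k)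
    {i : ℕ} : column Y alpha i = alpha ↔ i = m := by
  rw [column_eq_alpha]
  constructor
  · rintro ⟨hi, h, -⟩
    exact le_antisymm (h m hm) (hmin i hi)
  · rintro rfl
    exact ⟨hm, hmin, rfl⟩

lemma column_alpha_eq_beta_iff {Y : Finset ℕ} {m : ℕ} (hm : m ∈ Y) (hmin : ∀ k ∈ Y, m ≤ k)
    {i : ℕ} : column Y alpha i = beta ↔ i ∈ Y.erase m := by
  rw [column_eq_beta, mem_erase]
  constructor
  · rintro ⟨hi, h⟩
    refine ⟨?_, hi⟩
    rintro rfl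
    cases h hmin
  · rintro ⟨hne, hi⟩
    exact ⟨hi, fun h => absurd (le_antisymm (h m hm) (hmin i hi)) hne⟩

lemma stairWt_extend_alpha (α β : ℝ) {n : ℕ} {S : ℕ → ℕ → StairSymb} (hS : IsStaircase n S)
    {X : Finset ℕ} (hX : X ⊆ freeRows n S) :
    stairWt α β (extend n S X alpha) = stairWt α β S * (α * β ^ X.card) := by
  obtain ⟨m, hm, hmin⟩ := exists_isLeast n X
  unfold stairWt extend
  rw [ncard_consColumn hS (by simp) (Y := {m})
      (fun i => by rw [column_alpha_eq_alpha_iff hm hmin, mem_singleton]),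
    ncard_consColumn hS (by simp) (fun i => column_alpha_eq_beta_iff hm hmin),
    card_erase_of_mem hm, card_insert_of_notMem (notMem_of_subset_freeRows hX), card_singleton,
    Nat.add_sub_cancel]
  ring

lemma mem_freeRows_extend {n : ℕ} {S : ℕ → ℕ → StairSymb} (hS : IsStaircase n S)
    {X : Finset ℕ} {t : StairSymb} {i : ℕ} :
    i ∈ freeRows (n + 1) (extend n S X t) ↔
      (i = n + 1 ∨ i ∈ freeRows n S) ∧ column (insert (n + 1) X) t i ≠ beta := by
  rw [mem_freeRows, mem_freeRows]
  constructor
  · rintro ⟨hi, h⟩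
    refine ⟨?_, h 1⟩
    by_cases hin : i = n + 1
    · exact Or.inl hin
    · refine Or.inr ⟨by omega, fun j => ?_⟩
      match j with
      | 0 => rw [hS.1 _ _ (by omega)]; simp
      | j + 1 => exact h (j + 2)
  · rintro ⟨hi, hc⟩
    refine ⟨by omega, fun j => ?_⟩
    match j with
    | 0 => simp [extend, consColumn]
    | 1 => exact hc
    | j + 2 =>
      change S i (j + 1) ≠ beta
      rcases hi with rfl | hi
      · rw [hS.1 _ _ (by omega)]; simp
      · exact hi.2 _

lemma card_freeRows_extend_beta {n : ℕ} {S : ℕ → ℕ → StairSymb} (hS : IsStaircase n S)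
    {X : Finset ℕ} (hX : X ⊆ freeRows n S) :
    (freeRows (n + 1) (extend n S X beta)).card = (freeRows n S).card - X.card := by
  rw [← card_sdiff_of_subset hX]
  congr 1
  ext i
  rw [mem_freeRows_extend hS, Ne, column_eq_beta, mem_sdiff]
  have := notMem_of_subset_freeRows (subset_refl (freeRows n S))
  grind

lemma card_freeRows_extend_alpha {n : ℕ} {S : ℕ → ℕ → StairSymb} (hS : IsStaircase n S)
    {X : Finset ℕ} (hX : X ⊆ freeRows n S) :
    (freeRows (n + 1) (extend n S X alpha)).card = (freeRows n S).card - X.card + 1 := by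
  obtain ⟨m, hm, hmin⟩ := exists_isLeast n X
  have hn := notMem_of_subset_freeRows (subset_refl (freeRows n S))
  rw [← card_sdiff_of_subset hX, ← card_insert_of_notMem (s := freeRows n S \ X) (a := m)
    (by grind)]
  congr 1
  ext i
  rw [mem_freeRows_extend hS, Ne, column_alpha_eq_beta_iff hm hmin]
  grind

lemma secondBetas_eq_sum (n : ℕ) (S : ℕ → ℕ → StairSymb) :
    secondBetas n S = ∑ j ∈ range (n - 1), if S (n - (1 + j)) (1 + j) = beta then 1 else 0 := by
  rw [secondBetas, card_filter, ← Ico_add_one_right_eq_Icc, sum_Ico_eq_sum_range,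
    Nat.add_sub_cancel]

lemma secondBetas_extend {n : ℕ} {S : ℕ → ℕ → StairSymb}
    {X : Finset ℕ} (hX : X ⊆ freeRows n S) (t : StairSymb) :
    secondBetas (n + 1) (extend n S X t) =
      secondBetas n S + if column (insert (n + 1) X) t n = beta then 1 else 0 := by
  rw [secondBetas_eq_sum, secondBetas_eq_sum]
  cases n with
  | zero =>
    rw [if_neg]
    · simp
    · rw [column_eq_beta]
      rintro ⟨h, -⟩
      rcases mem_insert.1 h with h | h
      · omega
      · have := (mem_freeRows.1 (hX h)).1; omega
  | succ n =>
    rw [Nat.add_sub_cancel, Nat.add_sub_cancel, sum_range_succ']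
    congr 1
    refine sum_congr rfl fun j _ => ?_
    rw [show n + 1 + 1 - (1 + (j + 1)) = n + 1 - (1 + j) by omega,
      show 1 + (j + 1) = j + 2 by omega, show 1 + j = j + 1 by omega]
    rfl

lemma sum_powerset_weights (α β z : ℝ) (F : Finset ℕ) :
    ∑ X ∈ F.powerset, (α * β ^ X.card * z ^ (F.card - X.card + 1) +
      β * β ^ X.card * z ^ (F.card - X.card)) = (α * z + β) * (z + β) ^ F.card := by
  rw [add_comm z β, ← sum_pow_mul_eq_add_pow, mul_sum]
  exact sum_congr rfl fun X _ => by ring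

lemma lt_of_mem_erase_freeRows {n : ℕ} {S : ℕ → ℕ → StairSymb} {i : ℕ}
    (hi : i ∈ (freeRows n S).erase n) : i < n := by
  rw [mem_erase, mem_freeRows] at hi
  omega

lemma sum_column_of_notMem (α β z : ℝ) (φ : ℕ → ℝ) (b : ℕ) {n : ℕ} {F : Finset ℕ}
    (hF : n ∉ F) :
    ∑ X ∈ F.powerset, (α * β ^ X.card * z ^ (F.card - X.card + 1) *
          φ (b + if column (insert (n + 1) X) alpha n = beta then 1 else 0) +
        β * β ^ X.card * z ^ (F.card - X.card) *
          φ (b + if column (insert (n + 1) X) beta n = beta then 1 else 0)) =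
      (α * z + β) * (z + β) ^ F.card * φ b := by
  rw [← sum_powerset_weights, sum_mul]
  refine sum_congr rfl fun X hX => ?_
  have hn : n ∉ insert (n + 1) X := by
    rw [mem_insert, not_or]
    exact ⟨by omega, fun h => hF (mem_powerset.1 hX h)⟩
  simp only [column_eq_beta, hn, false_and, if_false, add_zero]
  ring

lemma sum_column_insert (α β z : ℝ) (φ : ℕ → ℝ) (b : ℕ) {n : ℕ} {F : Finset ℕ}
    (hF : ∀ i ∈ F, i < n) :
    ∑ X ∈ (insert n F).powerset, (α * β ^ X.card * z ^ ((insert n F).card - X.card + 1) *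
          φ (b + if column (insert (n + 1) X) alpha n = beta then 1 else 0) +
        β * β ^ X.card * z ^ ((insert n F).card - X.card) *
          φ (b + if column (insert (n + 1) X) beta n = beta then 1 else 0)) =
      (α * z + β) * (z + β) ^ (insert n F).card * φ b + (φ (b + 1) - φ b) *
        (β * (α * z + β) * (z + β) ^ F.card - α * β * z * z ^ F.card) := by
  have hnF : n ∉ F := fun h => lt_irrefl _ (hF n h)
  have h1 : ∀ X ∈ F.powerset, (α * β ^ X.card * z ^ ((insert n F).card - X.card + 1) *
          φ (b + if column (insert (n + 1) X) alpha n = beta then 1 else 0) +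
        β * β ^ X.card * z ^ ((insert n F).card - X.card) *
          φ (b + if column (insert (n + 1) X) beta n = beta then 1 else 0)) =
      (α * β ^ X.card * z ^ (F.card - X.card + 1) +
        β * β ^ X.card * z ^ (F.card - X.card)) * (z * φ b) := by
    intro X hX
    have hle := card_le_card (mem_powerset.1 hX)
    have hn : n ∉ insert (n + 1) X := by
      rw [mem_insert, not_or]
      exact ⟨by omega, fun h => hnF (mem_powerset.1 hX h)⟩
    simp only [column_eq_beta, hn, false_and, if_false, add_zero, card_insert_of_notMem hnF]
    rw [Nat.succ_sub hle, Nat.succ_eq_add_one]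
    ring
  have h2 : ∀ X ∈ F.powerset,
      (α * β ^ (insert n X).card * z ^ ((insert n F).card - (insert n X).card + 1) *
          φ (b + if column (insert (n + 1) (insert n X)) alpha n = beta then 1 else 0) +
        β * β ^ (insert n X).card * z ^ ((insert n F).card - (insert n X).card) *
          φ (b + if column (insert (n + 1) (insert n X)) beta n = beta then 1 else 0)) =
      (α * β ^ X.card * z ^ (F.card - X.card + 1) +
        β * β ^ X.card * z ^ (F.card - X.card)) * (β * φ (b + 1)) -
      if X = ∅ then α * β * z * z ^ F.card * (φ (b + 1) - φ b) else 0 := by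
    intro X hX
    have hX' := mem_powerset.1 hX
    have hnX : n ∉ X := fun h => hnF (hX' h)
    have hb : column (insert (n + 1) (insert n X)) beta n = beta := by simp [column_eq_beta]
    have ha : column (insert (n + 1) (insert n X)) alpha n = beta ↔ X ≠ ∅ := by
      rw [column_eq_beta]
      constructor
      · rintro ⟨-, h⟩ rfl
        have := h (by simp)
        cases this
      · intro h
        obtain ⟨i, hi⟩ := nonempty_iff_ne_empty.2 h
        refine ⟨by simp, fun h => ?_⟩
        have := h i (by simp [hi])
        have := hF i (hX' hi)
        omega
    simp only [hb, ha, if_true, card_insert_of_notMem hnF, card_insert_of_notMem hnX,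
      Nat.add_sub_add_right]
    by_cases h : X = ∅
    · simp only [h, ne_eq, not_true, if_false, if_true, card_empty, Nat.sub_zero, add_zero]
      ring
    · simp only [h, ne_eq, not_false_iff, if_false, if_true]
      ring
  rw [sum_powerset_insert hnF, sum_congr rfl h1, sum_congr rfl h2, sum_sub_distrib, ← sum_mul,
    ← sum_mul, sum_powerset_weights, sum_ite_eq', if_pos (empty_mem_powerset F),
    card_insert_of_notMem hnF]
  ring

/-- The total weight of the tableaux of size `n`, where each free row is marked by `z`
and `φ` is applied to the number of `beta`s on the second main diagonal. -/
noncomputable def markedSum (α β : ℝ) (n : ℕ) (φ : ℕ → ℝ) (z : ℝ) : ℝ :=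
  ∑ S ∈ tableaux n, stairWt α β S * z ^ (freeRows n S).card * φ (secondBetas n S)

lemma markedSum_succ (α β : ℝ) (n : ℕ) (φ : ℕ → ℝ) (z : ℝ) :
    markedSum α β (n + 1) φ z = (α * z + β) * markedSum α β n φ (z + β) +
      ∑ S ∈ tableaux n, if n ∈ freeRows n S then stairWt α β S *
        (φ (secondBetas n S + 1) - φ (secondBetas n S)) *
          (β * (α * z + β) * (z + β) ^ ((freeRows n S).card - 1) -
            α * β * z * z ^ ((freeRows n S).card - 1)) else 0 := by
  rw [markedSum, sum_tableaux_succ, markedSum, mul_sum, ← sum_add_distrib]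
  refine sum_congr rfl fun S hS => ?_
  rw [mem_tableaux] at hS
  have h : ∀ X ∈ (freeRows n S).powerset,
      stairWt α β (extend n S X alpha) * z ^ (freeRows (n + 1) (extend n S X alpha)).card *
          φ (secondBetas (n + 1) (extend n S X alpha)) +
        stairWt α β (extend n S X beta) * z ^ (freeRows (n + 1) (extend n S X beta)).card *
          φ (secondBetas (n + 1) (extend n S X beta)) =
      stairWt α β S * (α * β ^ X.card * z ^ ((freeRows n S).card - X.card + 1) *
          φ (secondBetas n S + if column (insert (n + 1) X) alpha n = beta then 1 else 0) +
        β * β ^ X.card * z ^ ((freeRows n S).card - X.card) *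
          φ (secondBetas n S + if column (insert (n + 1) X) beta n = beta then 1 else 0)) := by
    intro X hX
    rw [mem_powerset] at hX
    rw [stairWt_extend_alpha α β hS hX, stairWt_extend_beta α β hS hX,
      card_freeRows_extend_alpha hS hX, card_freeRows_extend_beta hS hX,
      secondBetas_extend hX, secondBetas_extend hX]
    ring
  rw [sum_congr rfl h, ← mul_sum]
  split_ifs with hn
  · have hi := sum_column_insert α β z φ (secondBetas n S) (n := n) (F := (freeRows n S).erase n)
      fun i hi => lt_of_mem_erase_freeRows hi
    rw [insert_erase hn, card_erase_of_mem hn] at hi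
    rw [hi]
    ring
  · rw [sum_column_of_notMem α β z φ _ hn]
    ring

lemma last_mem_freeRows_extend_beta {n : ℕ} {S : ℕ → ℕ → StairSymb} (hS : IsStaircase n S)
    {X : Finset ℕ} : n + 1 ∉ freeRows (n + 1) (extend n S X beta) := by
  simp [mem_freeRows_extend hS, column_eq_beta]

lemma last_mem_freeRows_extend_alpha {n : ℕ} {S : ℕ → ℕ → StairSymb} (hS : IsStaircase n S)
    {X : Finset ℕ} (hX : X ⊆ freeRows n S) :
    n + 1 ∈ freeRows (n + 1) (extend n S X alpha) ↔ X = ∅ := by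
  rw [mem_freeRows_extend hS, Ne, column_eq_beta]
  constructor
  · rintro ⟨-, h⟩
    by_contra hne
    obtain ⟨i, hi⟩ := nonempty_iff_ne_empty.2 hne
    refine h ⟨mem_insert_self _ _, fun h => ?_⟩
    have := h i (mem_insert_of_mem hi)
    have := mem_freeRows.1 (hX hi)
    omega
  · rintro rfl
    exact ⟨Or.inl rfl, fun h => by simp at h⟩

lemma markedSum_add_two (α β : ℝ) (n : ℕ) (φ : ℕ → ℝ) (z : ℝ) :
    markedSum α β (n + 2) φ z = (α * z + β) * markedSum α β (n + 1) φ (z + β) +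
      α * β * ((α * z + β) * markedSum α β n (fun b => φ (b + 1) - φ b) (z + β) -
        α * z * markedSum α β n (fun b => φ (b + 1) - φ b) z) := by
  rw [markedSum_succ, sum_tableaux_succ]
  congr 1
  rw [markedSum, markedSum, mul_sum, mul_sum, ← sum_sub_distrib, mul_sum]
  refine sum_congr rfl fun S hS => ?_
  rw [mem_tableaux] at hS
  simp only [last_mem_freeRows_extend_beta hS, if_false, add_zero]
  rw [sum_eq_single_of_mem ∅ (empty_mem_powerset _)]
  · rw [if_pos ((last_mem_freeRows_extend_alpha hS (empty_subset _)).2 rfl),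
      stairWt_extend_alpha α β hS (empty_subset _),
      card_freeRows_extend_alpha hS (empty_subset _), secondBetas_extend (empty_subset _), if_neg]
    · simp only [card_empty, Nat.sub_zero, Nat.add_sub_cancel, pow_zero, add_zero]
      ring
    · simp [column_eq_beta]
  · intro X hX hne
    rw [if_neg (mt (last_mem_freeRows_extend_alpha hS (mem_powerset.1 hX)).1 hne)]

lemma stairWt_empty (α β : ℝ) : stairWt α β (fun _ _ => empty) = 1 := by
  simp [stairWt]

lemma markedSum_zero (α β : ℝ) (φ : ℕ → ℝ) (z : ℝ) : markedSum α β 0 φ z = φ 0 := by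
  simp [markedSum, tableaux, freeRows, secondBetas, stairWt_empty]

lemma markedSum_one (α β : ℝ) (φ : ℕ → ℝ) (z : ℝ) :
    markedSum α β 1 φ z = (α * z + β) * φ 0 := by
  rw [markedSum_succ, markedSum_zero]
  simp [freeRows]

/-- The total weight of the tableaux of size `n` with free rows marked by `z`. -/
noncomputable def rowGen (α β : ℝ) (n : ℕ) (z : ℝ) : ℝ :=
  ∏ k ∈ range n, (α * z + β + k * (α * β))

lemma rowGen_succ (α β : ℝ) (n : ℕ) (z : ℝ) :
    rowGen α β (n + 1) z = rowGen α β n z * (α * z + β + n * (α * β)) :=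
  prod_range_succ _ _

lemma rowGen_succ' (α β : ℝ) (n : ℕ) (z : ℝ) :
    rowGen α β (n + 1) z = (α * z + β) * rowGen α β n (z + β) := by
  rw [rowGen, prod_range_succ', mul_comm, rowGen]
  simp only [Nat.cast_zero, zero_mul, add_zero]
  congr 1
  refine prod_congr rfl fun k _ => ?_
  push_cast
  ring

/-- The coefficients in the factorial moments: complete homogeneous symmetric polynomials
of degree `r` in the variables `β * (1 + i * α)`, `i ≤ m`. -/
noncomputable def hsymmCoeff (α β : ℝ) : ℕ → ℕ → ℝ
  | 0, _ => 1
  | r + 1, m => ∑ i ∈ range (m + 1), β * (1 + i * α) * hsymmCoeff α β r i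

lemma markedSum_const (α β c : ℝ) (n : ℕ) (z : ℝ) :
    markedSum α β n (fun _ => c) z = rowGen α β n z * c := by
  induction n generalizing z with
  | zero => simp [markedSum_zero, rowGen]
  | succ n ih =>
    rw [markedSum_succ, ih, rowGen_succ']
    simp [mul_assoc]

lemma choose_succ_sub_choose (r : ℕ) :
    (fun b : ℕ => (((b + 1).choose (r + 1) : ℕ) : ℝ) - (b.choose (r + 1) : ℕ)) =
      fun b => ((b.choose r : ℕ) : ℝ) := by
  funext b
  rw [Nat.choose_succ_succ]
  push_cast
  ring

lemma markedSum_choose_of_lt (α β : ℝ) {n r : ℕ} (h : n < 2 * r) (z : ℝ) :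
    markedSum α β n (fun b => (b.choose r : ℕ)) z = 0 := by
  induction n using Nat.twoStepInduction generalizing r z with
  | zero =>
    obtain ⟨r, rfl⟩ := Nat.exists_eq_add_of_le' (show 1 ≤ r by omega)
    simp [markedSum_zero]
  | one =>
    obtain ⟨r, rfl⟩ := Nat.exists_eq_add_of_le' (show 1 ≤ r by omega)
    simp [markedSum_one]
  | more n ih₀ ih₁ =>
    obtain ⟨r, rfl⟩ := Nat.exists_eq_add_of_le' (show 1 ≤ r by omega)
    rw [markedSum_add_two, choose_succ_sub_choose, ih₁ (by omega), ih₀ (by omega),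
      ih₀ (by omega)]
    ring

/-- The generating function of the binomial moments of the number of `beta`s on the second
main diagonal, in closed form. -/
lemma markedSum_choose (α β : ℝ) (r m : ℕ) (z : ℝ) :
    markedSum α β (m + 2 * r) (fun b => (b.choose r : ℕ)) z =
      (α * β) ^ r * hsymmCoeff α β r m * rowGen α β m z := by
  induction r generalizing m z with
  | zero =>
    simp only [Nat.choose_zero_right, Nat.cast_one, mul_zero, add_zero, markedSum_const]
    simp [hsymmCoeff]
  | succ r ihr =>
    have key : ∀ m z, markedSum α β (m + 2 * (r + 1)) (fun b => (b.choose (r + 1) : ℕ)) z =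
        (α * z + β) * markedSum α β (m + 2 * r + 1) (fun b => (b.choose (r + 1) : ℕ)) (z + β) +
          (α * β) ^ (r + 1) * (β * (1 + m * α) * hsymmCoeff α β r m) * rowGen α β m z := by
      intro m z
      have h : (α * z + β) * rowGen α β m (z + β) =
          rowGen α β m z * (α * z + β + m * (α * β)) := by
        rw [← rowGen_succ', rowGen_succ]
      rw [show m + 2 * (r + 1) = m + 2 * r + 2 by ring, markedSum_add_two,
        choose_succ_sub_choose, ihr, ihr]
      linear_combination (α * β) ^ (r + 1) * hsymmCoeff α β r m * h
    induction m generalizing z with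
    | zero =>
      rw [key, markedSum_choose_of_lt α β (by omega)]
      simp [hsymmCoeff]
    | succ m ihm =>
      rw [key, show m + 1 + 2 * r + 1 = m + 2 * (r + 1) by ring, ihm, rowGen_succ']
      simp only [hsymmCoeff]
      rw [sum_range_succ _ (m + 1)]
      push_cast
      ring

open Filter Topology

/-- Weighted Cesàro: the partial sums of `f` and `g` have the same limiting quotient
as their terms. -/
lemma tendsto_sum_div_sum {f g : ℕ → ℝ} {L : ℝ} (hg : ∀ n, 0 < g n)
    (hsum : Tendsto (fun n => ∑ i ∈ range n, g i) atTop atTop)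
    (h : Tendsto (fun n => f n / g n) atTop (𝓝 L)) :
    Tendsto (fun n => (∑ i ∈ range n, f i) / ∑ i ∈ range n, g i) atTop (𝓝 L) := by
  have ho : (fun n => f n - L * g n) =o[atTop] g := by
    rw [Asymptotics.isLittleO_iff_tendsto fun n hn => absurd hn (hg n).ne']
    have h' := h.sub_const L
    rw [sub_self] at h'
    refine h'.congr fun n => ?_
    rw [sub_div, mul_div_cancel_right₀ _ (hg n).ne']
  have ho' := (ho.sum_range (fun n => (hg n).le) hsum).tendsto_div_nhds_zero.add_const L
  rw [zero_add] at ho'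
  refine ho'.congr' ?_
  filter_upwards [hsum.eventually_gt_atTop 0] with n hn
  rw [sum_sub_distrib, ← mul_sum, sub_div, mul_div_cancel_right₀ _ hn.ne', sub_add_cancel]

lemma tendsto_sum_choose_atTop (p : ℕ) :
    Tendsto (fun n => ∑ i ∈ range n, (((i + p).choose p : ℕ) : ℝ)) atTop atTop := by
  refine tendsto_atTop_mono (fun n => ?_) tendsto_natCast_atTop_atTop
  calc (n : ℝ) = ∑ i ∈ range n, (1 : ℝ) := by simp
    _ ≤ _ := sum_le_sum fun i _ => by
      exact_mod_cast Nat.choose_pos (Nat.le_add_left p i)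

lemma cast_add_choose_succ (m p : ℕ) :
    (((m + (p + 1)).choose (p + 1) : ℕ) : ℝ) =
      ((m + p).choose p : ℕ) * ((m + p + 1) / (p + 1)) := by
  have h := Nat.add_one_mul_choose_eq (m + p) p
  have hp : (p : ℝ) + 1 ≠ 0 := by positivity
  rw [← mul_div_assoc, eq_div_iff hp, ← add_assoc]
  have h' : ((m : ℝ) + p + 1) * ((m + p).choose p : ℕ) =
    ((m + p + 1).choose (p + 1) : ℕ) * (p + 1) := by exact_mod_cast h
  linarith

lemma hsymmCoeff_limit_succ (α β : ℝ) (r : ℕ) :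
    (α * β) ^ (r + 1) * (2 * (r + 1)).factorial / (2 ^ (r + 1) * (r + 1).factorial) =
      (α * β) ^ r * (2 * r).factorial / (2 ^ r * r.factorial) * ((2 * r + 1) * (α * β)) := by
  have h1 : (r.factorial : ℝ) ≠ 0 := by positivity
  rw [show 2 * (r + 1) = 2 * r + 1 + 1 by ring, Nat.factorial_succ, Nat.factorial_succ,
    Nat.factorial_succ]
  push_cast
  field_simp
  ring

lemma tendsto_hsymmCoeff (α β : ℝ) (r : ℕ) :
    Tendsto (fun m => hsymmCoeff α β r m / ((m + 2 * r).choose (2 * r) : ℕ)) atTop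
      (𝓝 ((α * β) ^ r * (2 * r).factorial / (2 ^ r * r.factorial))) := by
  induction r with
  | zero => simp [hsymmCoeff]
  | succ r ih =>
    have hpos : ∀ i, (0 : ℝ) < ((i + (2 * r + 1)).choose (2 * r + 1) : ℕ) := fun i => by
      exact_mod_cast Nat.choose_pos (Nat.le_add_left _ i)
    have hterm : Tendsto (fun i : ℕ => β * (1 + i * α) * hsymmCoeff α β r i /
        ((i + (2 * r + 1)).choose (2 * r + 1) : ℕ)) atTop
        (𝓝 ((α * β) ^ r * (2 * r).factorial / (2 ^ r * r.factorial) *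
          ((2 * r + 1) * (α * β)))) := by
      have hlin := (tendsto_add_mul_div_add_mul_atTop_nhds β (2 * r + 1 : ℝ) (α * β)
        one_ne_zero).const_mul (2 * r + 1 : ℝ)
      rw [div_one] at hlin
      refine (ih.mul hlin).congr fun i => ?_
      rw [cast_add_choose_succ]
      have h1 : (((i + 2 * r).choose (2 * r) : ℕ) : ℝ) ≠ 0 := by
        exact_mod_cast (Nat.choose_pos (Nat.le_add_left _ i)).ne'
      have h2 : (2 * r + 1 : ℝ) ≠ 0 := by positivity
      have h3 : (2 * r + 1 + 1 * i : ℝ) ≠ 0 := by positivity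
      have h4 : (i + 2 * r + 1 : ℝ) ≠ 0 := by positivity
      push_cast
      field_simp
      ring
    rw [← hsymmCoeff_limit_succ] at hterm
    have hc := (tendsto_sum_div_sum hpos (tendsto_sum_choose_atTop _) hterm).comp
      (tendsto_add_atTop_nat 1)
    refine hc.congr fun m => ?_
    have hs : (∑ i ∈ range (m + 1), (((i + (2 * r + 1)).choose (2 * r + 1) : ℕ) : ℝ)) =
        ((m + 2 * (r + 1)).choose (2 * (r + 1)) : ℕ) := by
      exact_mod_cast Nat.sum_range_add_choose m (2 * r + 1)
    simp only [Function.comp_apply, hs, hsymmCoeff]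

lemma rowGen_pos {α β z : ℝ} (hα : 0 < α) (hβ : 0 < β) (hz : 0 ≤ z) (n : ℕ) :
    0 < rowGen α β n z :=
  prod_pos fun _ _ => by positivity

lemma tendsto_choose_mul_rowGen {α β z : ℝ} (hα : 0 < α) (hβ : 0 < β) (hz : 0 ≤ z) (p : ℕ) :
    Tendsto (fun m => ((m + p).choose p : ℕ) * (rowGen α β m z / rowGen α β (m + p) z)) atTop
      (𝓝 (1 / (p.factorial * (α * β) ^ p))) := by
  induction p with
  | zero =>
    refine tendsto_const_nhds.congr fun m => ?_
    simp [div_self (rowGen_pos hα hβ hz m).ne']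
  | succ p ih =>
    have hαβ : α * β ≠ 0 := by positivity
    have hlin := (tendsto_add_mul_div_add_mul_atTop_nhds (p + 1 : ℝ)
      (α * z + β + p * (α * β)) 1 hαβ).const_mul (1 / (p + 1 : ℝ))
    have h := ih.mul hlin
    have hlim : 1 / (p.factorial * (α * β) ^ p) * (1 / (p + 1 : ℝ) * (1 / (α * β))) =
        1 / ((p + 1).factorial * (α * β) ^ (p + 1)) := by
      rw [Nat.factorial_succ]
      push_cast
      field_simp
      ring
    rw [hlim] at h
    refine h.congr fun m => ?_
    have h1 := (rowGen_pos hα hβ hz (m + p)).ne'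
    have h2 : α * z + β + p * (α * β) + α * β * m ≠ 0 := by positivity
    have h3 : α * z + β + (m + p) * (α * β) ≠ 0 := by positivity
    rw [cast_add_choose_succ, ← add_assoc, rowGen_succ]
    push_cast
    field_simp
    ring

/-- The `r`-th binomial moment of the number of `beta`s on the second main diagonal. -/
noncomputable def binomMoment (α β : ℝ) (r n : ℕ) : ℝ :=
  markedSum α β n (fun b => (b.choose r : ℕ)) 1 / rowGen α β n 1

lemma tendsto_binomMoment {α β : ℝ} (hα : 0 < α) (hβ : 0 < β) (r : ℕ) :
    Tendsto (binomMoment α β r) atTop (𝓝 ((1 / 2) ^ r / r.factorial)) := by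
  rw [← tendsto_add_atTop_iff_nat (2 * r)]
  have h := ((tendsto_hsymmCoeff α β r).mul
    (tendsto_choose_mul_rowGen hα hβ zero_le_one (2 * r))).const_mul ((α * β) ^ r)
  have hlim : (α * β) ^ r * ((α * β) ^ r * (2 * r).factorial / (2 ^ r * r.factorial) *
      (1 / ((2 * r).factorial * (α * β) ^ (2 * r)))) = (1 / 2) ^ r / r.factorial := by
    have h1 : ((2 * r).factorial : ℝ) ≠ 0 := by positivity
    have h2 : (α * β) ^ r ≠ 0 := by positivity
    rw [two_mul r, pow_add, ← two_mul, one_div_pow]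
    field_simp
  rw [hlim] at h
  refine h.congr fun m => ?_
  have h1 : (((m + 2 * r).choose (2 * r) : ℕ) : ℝ) ≠ 0 := by
    exact_mod_cast (Nat.choose_pos (Nat.le_add_left _ m)).ne'
  rw [binomMoment, markedSum_choose]
  field_simp

/-- Bonferroni inequality for the indicator of `b = k`. -/
lemma abs_indicator_sub_sum_choose_le (b k R : ℕ) :
    |(if b = k then 1 else 0) - ∑ s ∈ range (R + 1),
        (-1 : ℝ) ^ s * ((k + s).choose k : ℕ) * (b.choose (k + s) : ℕ)| ≤
      ((k + (R + 1)).choose k : ℕ) * (b.choose (k + (R + 1)) : ℕ) := by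
  rcases lt_or_ge b k with hb | hb
  · have h : ∀ s, b.choose (k + s) = 0 := fun s => Nat.choose_eq_zero_of_lt (by omega)
    simp [h, hb.ne]
  obtain ⟨N, rfl⟩ := Nat.exists_eq_add_of_le hb
  have h : ∀ s, (((k + s).choose k : ℕ) : ℝ) * ((k + N).choose (k + s) : ℕ) =
      ((k + N).choose k : ℕ) * (N.choose s : ℕ) := by
    intro s
    have := Nat.choose_mul (n := k + N) (k := k + s) (s := k) (Nat.le_add_right k s)
    rw [Nat.add_sub_cancel_left, Nat.add_sub_cancel_left, mul_comm] at this
    exact_mod_cast this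
  have h' : ∑ s ∈ range (R + 1),
      (-1 : ℝ) ^ s * ((k + s).choose k : ℕ) * ((k + N).choose (k + s) : ℕ) =
      ((k + N).choose k : ℕ) * ∑ s ∈ range (R + 1), (-1 : ℝ) ^ s * (N.choose s : ℕ) := by
    rw [mul_sum]
    refine sum_congr rfl fun s _ => ?_
    rw [mul_assoc, h]
    ring
  rw [h', h]
  cases N with
  | zero =>
    rw [sum_range_succ', sum_eq_zero (fun s _ => by simp)]
    simp
  | succ N =>
    have ha : ∑ s ∈ range (R + 1), (-1 : ℝ) ^ s * ((N + 1).choose s : ℕ) =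
        (-1) ^ R * (N.choose R : ℕ) := by
      exact_mod_cast Int.alternating_sum_range_choose_eq_choose (n := N) (m := R)
    rw [ha, if_neg (by omega), zero_sub, abs_neg, abs_mul, abs_mul, abs_pow, abs_neg, abs_one,
      one_pow, one_mul, Nat.abs_cast, Nat.abs_cast, Nat.choose_succ_succ]
    gcongr
    exact Nat.le_add_right _ _

/-- Convergence of the binomial moments together with the Bonferroni inequalities gives
convergence of the point probabilities to those of a Poisson law. -/
lemma tendsto_poisson_of_binomMoments {p : ℕ → ℝ} {M : ℕ → ℕ → ℝ} {lam : ℝ} (k : ℕ)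
    (hp : ∀ n R, |p n - ∑ s ∈ range (R + 1),
        (-1 : ℝ) ^ s * ((k + s).choose k : ℕ) * M (k + s) n| ≤
      ((k + (R + 1)).choose k : ℕ) * M (k + (R + 1)) n)
    (hM : ∀ r, Tendsto (M r) atTop (𝓝 (lam ^ r / r.factorial))) :
    Tendsto p atTop (𝓝 (Real.exp (-lam) * lam ^ k / k.factorial)) := by
  have ha : ∀ s, (((k + s).choose k : ℕ) : ℝ) * (lam ^ (k + s) / (k + s).factorial) =
      lam ^ k / k.factorial * (lam ^ s / s.factorial) := by
    intro s
    have h : (((k + s).choose k : ℕ) : ℝ) * k.factorial * s.factorial = (k + s).factorial := by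
      have := Nat.add_choose_mul_factorial_mul_factorial s k
      rw [add_comm s k] at this
      rw [← this]
      push_cast
      ring
    have h1 : (k.factorial : ℝ) ≠ 0 := by positivity
    have h2 : (s.factorial : ℝ) ≠ 0 := by positivity
    have h3 : ((k + s).choose k : ℝ) ≠ 0 := by
      exact_mod_cast (Nat.choose_pos (Nat.le_add_right k s)).ne'
    rw [← h, pow_add]
    field_simp
  have hlim : Tendsto (fun R => ∑ s ∈ range (R + 1), (-1 : ℝ) ^ s * ((k + s).choose k : ℕ) *
      (lam ^ (k + s) / (k + s).factorial)) atTop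
      (𝓝 (Real.exp (-lam) * lam ^ k / k.factorial)) := by
    have hs := ((NormedSpace.expSeries_div_hasSum_exp (-lam)).mul_left
      (lam ^ k / k.factorial)).tendsto_sum_nat.comp (tendsto_add_atTop_nat 1)
    rw [← Real.exp_eq_exp_ℝ, div_mul_comm, mul_comm (_ / _), ← mul_div_assoc,
      mul_comm (lam ^ k)] at hs
    refine hs.congr fun R => sum_congr rfl fun s _ => ?_
    rw [mul_assoc, ha, neg_pow]
    ring
  have hzero : Tendsto (fun R => (((k + (R + 1)).choose k : ℕ) : ℝ) *
      (lam ^ (k + (R + 1)) / (k + (R + 1)).factorial)) atTop (𝓝 0) := by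
    have h := ((FloorSemiring.tendsto_pow_div_factorial_atTop lam).comp
      (tendsto_add_atTop_nat 1)).const_mul (lam ^ k / k.factorial)
    rw [mul_zero] at h
    exact h.congr fun R => (ha (R + 1)).symm
  rw [Metric.tendsto_nhds]
  intro ε hε
  obtain ⟨R, hR1, hR2⟩ := ((Metric.tendsto_nhds.1 hlim (ε / 3) (by positivity)).and
    (hzero.eventually_lt_const (show (0 : ℝ) < ε / 3 by positivity))).exists
  have h1 : Tendsto (fun n => ∑ s ∈ range (R + 1), (-1 : ℝ) ^ s * ((k + s).choose k : ℕ) *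
      M (k + s) n) atTop (𝓝 (∑ s ∈ range (R + 1), (-1 : ℝ) ^ s * ((k + s).choose k : ℕ) *
      (lam ^ (k + s) / (k + s).factorial))) :=
    tendsto_finsetSum _ fun s _ => (hM (k + s)).const_mul _
  have h2 := (hM (k + (R + 1))).const_mul (((k + (R + 1)).choose k : ℕ) : ℝ)
  filter_upwards [Metric.tendsto_nhds.1 h1 (ε / 3) (by positivity),
    h2.eventually_lt_const hR2] with n hn1 hn2
  rw [Real.dist_eq] at *
  have := hp n R
  rw [abs_lt] at *
  rw [abs_le] at this
  constructor <;> linarith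

lemma sum_eq_markedSum (α β : ℝ) (n : ℕ) (φ : ℕ → ℝ) :
    ∑ S ∈ tableaux n, φ (secondBetas n S) * stairWt α β S = markedSum α β n φ 1 :=
  sum_congr rfl fun S _ => by rw [one_pow, mul_one, mul_comm]

lemma finsum_isStaircase (n : ℕ) (f : (ℕ → ℕ → StairSymb) → ℝ) :
    ∑ᶠ S ∈ {S : ℕ → ℕ → StairSymb | IsStaircase n S}, f S = ∑ S ∈ tableaux n, f S := by
  rw [← finsum_mem_coe_finset]
  congr! 3
  exact mem_tableaux.symm

lemma stairZ_eq (n : ℕ) (α β : ℝ) : stairZ n α β = rowGen α β n 1 := by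
  rw [stairZ, finsum_isStaircase, ← mul_one (rowGen α β n 1), ← markedSum_const,
    ← sum_eq_markedSum]
  exact sum_congr rfl fun S _ => (one_mul _).symm

lemma stairE_secondBetas (n : ℕ) (α β : ℝ) (φ : ℕ → ℝ) :
    stairE n α β (fun S => φ (secondBetas n S)) = markedSum α β n φ 1 / rowGen α β n 1 := by
  rw [stairE, finsum_isStaircase, stairZ_eq, sum_eq_markedSum]

open Classical in
lemma stairP_eq_stairE (n : ℕ) (α β : ℝ) (E : (ℕ → ℕ → StairSymb) → Prop) :
    stairP n α β E = stairE n α β (fun S => if E S then 1 else 0) := by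
  rw [stairP, stairE, finsum_isStaircase]
  have h : {S : ℕ → ℕ → StairSymb | IsStaircase n S ∧ E S} =
      ((tableaux n).filter E : Finset (ℕ → ℕ → StairSymb)) := by
    ext S
    simp [mem_tableaux]
  rw [h, finsum_mem_coe_finset, sum_filter]
  congr 1
  exact sum_congr rfl fun S _ => by split_ifs <;> simp

lemma stairP_secondBetas (n : ℕ) (α β : ℝ) (k : ℕ) :
    stairP n α β (fun S => secondBetas n S = k) =
      markedSum α β n (fun b => if b = k then 1 else 0) 1 / rowGen α β n 1 := by
  rw [stairP_eq_stairE, ← stairE_secondBetas]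
  refine congrArg _ (funext fun S => ?_)
  congr

lemma stairWt_nonneg {α β : ℝ} (hα : 0 < α) (hβ : 0 < β) (S : ℕ → ℕ → StairSymb) :
    0 ≤ stairWt α β S := by
  unfold stairWt
  positivity

lemma abs_stairP_sub_sum_binomMoment_le {α β : ℝ} (hα : 0 < α) (hβ : 0 < β) (k n R : ℕ) :
    |stairP n α β (fun S => secondBetas n S = k) - ∑ s ∈ range (R + 1),
        (-1 : ℝ) ^ s * ((k + s).choose k : ℕ) * binomMoment α β (k + s) n| ≤
      ((k + (R + 1)).choose k : ℕ) * binomMoment α β (k + (R + 1)) n := by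
  have hW := rowGen_pos hα hβ zero_le_one n
  simp only [stairP_secondBetas, binomMoment, ← mul_div_assoc]
  rw [← sum_div, ← sub_div, abs_div, abs_of_pos hW]
  gcongr
  simp only [← sum_eq_markedSum, mul_sum]
  rw [sum_comm, ← sum_sub_distrib]
  refine (abs_sum_le_sum_abs _ _).trans (sum_le_sum fun S _ => ?_)
  have hw := stairWt_nonneg hα hβ S
  simp only [← mul_assoc]
  rw [← sum_mul, ← sub_mul, abs_mul, abs_of_nonneg hw]
  exact mul_le_mul_of_nonneg_right (abs_indicator_sub_sum_choose_le _ k R) hw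

end StaircaseTableau

/-- The number `B_n` of β's on the second main diagonal has r-th factorial moment
converging to `(1/2)^r`, and converges in distribution to `Pois(1/2)`. -/
theorem betas_second_diagonal_poisson
    (α β : ℝ) (hα : 0 < α) (hβ : 0 < β) :
    (∀ r : ℕ, 1 ≤ r →
      Filter.Tendsto (fun n : ℕ =>
          stairE n α β (fun S =>
            (Nat.descFactorial
              (((Finset.Icc 1 (n - 1)).filter
                (fun j => S (n - j) j = StairSymb.beta)).card) r : ℝ)))
        Filter.atTop (nhds ((1 / 2 : ℝ) ^ r))) ∧
    (∀ k : ℕ,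
      Filter.Tendsto (fun n : ℕ =>
          stairP n α β (fun S =>
            (((Finset.Icc 1 (n - 1)).filter
              (fun j => S (n - j) j = StairSymb.beta)).card) = k))
        Filter.atTop
        (nhds (Real.exp (-(1 / 2 : ℝ)) * (1 / 2 : ℝ) ^ k / (Nat.factorial k : ℝ)))) := by
  constructor
  · intro r _
    have h := (StaircaseTableau.tendsto_binomMoment hα hβ r).const_mul (r.factorial : ℝ)
    rw [mul_div_cancel₀ _ (by positivity)] at h
    refine h.congr fun n => ?_
    refine Eq.trans ?_ (StaircaseTableau.stairE_secondBetas n α β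
      (fun b => (b.descFactorial r : ℕ))).symm
    simp only [Nat.descFactorial_eq_factorial_mul_choose, Nat.cast_mul,
      StaircaseTableau.binomMoment, StaircaseTableau.markedSum, ← mul_div_assoc, Finset.mul_sum]
    congr 1
    exact Finset.sum_congr rfl fun S _ => by ring
  · intro k
    exact StaircaseTableau.tendsto_poisson_of_binomMoments k
      (fun n R => StaircaseTableau.abs_stairP_sub_sum_binomMoment_le hα hβ k n R)
      (StaircaseTableau.tendsto_binomMoment hα hβ)
end

section
/- Let n ≥ 1, let α, β > 0 with a = 1/α and b = 1/β, let r ≥ 1, and let 1 ≤ j_1 < ⋯ < j_r ≤ n−1 satisfy j_{k+1} ≥ j_k + 2 for all k = 1, …, r−1. Then the probability under ℙ_{n,α,β} that, for every l = 1, …, r, the box (n−j_l, j_l) is nonempty equals ∏_{l=1}^r 1/(n+a+b−l). -/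
open scoped BigOperators

open Finset StairSymb

instance StairSymb.instFinite : Finite StairSymb :=
  Finite.of_surjective (fun k : Fin 3 => if k = 0 then empty else if k = 1 then alpha else beta)
    (by rintro (_ | _ | _); exacts [⟨0, rfl⟩, ⟨1, rfl⟩, ⟨2, rfl⟩])

/-! ### Columns of a tableau -/

/-- Fillings of a column supported on the rows in `F`, all boxes above an `alpha` being empty. -/
def columnSet (F : Finset ℕ) : Set (ℕ → StairSymb) :=
  {c | (∀ i, c i ≠ empty → i ∈ F) ∧ ∀ i i', i < i' → c i' = alpha → c i = empty}

theorem columnSet_finite (F : Finset ℕ) : (columnSet F).Finite := by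
  refine Set.Finite.of_finite_image (f := fun c => fun i : F => c i) (Set.toFinite _) ?_
  intro c hc d hd h
  funext i
  by_cases hi : i ∈ F
  · exact congrFun h ⟨i, hi⟩
  · rw [not_imp_comm.1 (hc.1 i) hi, not_imp_comm.1 (hd.1 i) hi]

/-- The finite set of fillings of a column supported on `F`. -/
noncomputable def columns (F : Finset ℕ) : Finset (ℕ → StairSymb) := (columnSet_finite F).toFinset

theorem mem_columns {F : Finset ℕ} {c : ℕ → StairSymb} :
    c ∈ columns F ↔
      (∀ i, c i ≠ empty → i ∈ F) ∧ ∀ i i', i < i' → c i' = alpha → c i = empty := by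
  simp [columns, columnSet]

/-- The column whose only nonempty box is an `alpha` in row `t`. -/
def alphaColumn (t : ℕ) : ℕ → StairSymb := Function.update (fun _ => empty) t alpha

theorem eq_empty_of_mem_columns {F : Finset ℕ} {c : ℕ → StairSymb} (hc : c ∈ columns F) {i : ℕ}
    (hi : i ∉ F) : c i = empty :=
  not_imp_comm.1 ((mem_columns.1 hc).1 i) hi

theorem sum_columns_insert {F : Finset ℕ} {t : ℕ} (ht : ∀ i ∈ F, i < t)
    (w : (ℕ → StairSymb) → ℝ) :
    ∑ c ∈ columns (insert t F), w c =
      ∑ c ∈ columns F, w c + w (alphaColumn t) +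
        ∑ c ∈ columns F, w (Function.update c t beta) := by
  classical
  have htF : t ∉ F := fun h => lt_irrefl _ (ht t h)
  have hsplit : columns (insert t F) = columns F ∪ {alphaColumn t} ∪
      (columns F).image (fun c => Function.update c t beta) := by
    ext c
    simp only [mem_union, mem_singleton, mem_image]
    constructor
    · intro hc
      obtain ⟨h1, h2⟩ := mem_columns.1 hc
      rcases hct : c t with _ | _ | _
      · refine Or.inl (Or.inl (mem_columns.2 ⟨fun i hi => ?_, h2⟩))
        rcases mem_insert.1 (h1 i hi) with rfl | h
        · exact absurd hct hi
        · exact h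
      · refine Or.inl (Or.inr ?_)
        funext i
        by_cases hi : i = t
        · subst hi; simp [alphaColumn, hct]
        · simp only [alphaColumn, Function.update_of_ne hi]
          by_contra hne
          rcases mem_insert.1 (h1 i hne) with h | h
          · exact hi h
          · exact hne (h2 i t (ht i h) hct)
      · refine Or.inr ⟨Function.update c t empty, mem_columns.2 ⟨fun i hi => ?_, ?_⟩, ?_⟩
        · by_cases hit : i = t
          · simp [hit] at hi
          · rw [Function.update_of_ne hit] at hi
            exact (mem_insert.1 (h1 i hi)).resolve_left hit
        · intro i i' hii h
          by_cases hit : i' = t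
          · simp [hit] at h
          · rw [Function.update_of_ne hit] at h
            by_cases hi : i = t
            · simp [hi]
            · rw [Function.update_of_ne hi]; exact h2 i i' hii h
        · simp [← hct]
    · rintro ((hc | rfl) | ⟨d, hd, rfl⟩)
      · obtain ⟨h1, h2⟩ := mem_columns.1 hc
        exact mem_columns.2 ⟨fun i hi => mem_insert_of_mem (h1 i hi), h2⟩
      · refine mem_columns.2 ⟨fun i hi => ?_, fun i i' hii h => ?_⟩
        · by_contra hne
          simp only [mem_insert, not_or] at hne
          simp [alphaColumn, Function.update_of_ne hne.1] at hi
        · have : i' = t := by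
            by_contra hne
            simp [alphaColumn, Function.update_of_ne hne] at h
          simp [alphaColumn, Function.update_of_ne (this ▸ hii.ne)]
      · obtain ⟨h1, h2⟩ := mem_columns.1 hd
        refine mem_columns.2 ⟨fun i hi => ?_, fun i i' hii h => ?_⟩
        · by_cases hit : i = t
          · simp [hit]
          · rw [Function.update_of_ne hit] at hi
            exact mem_insert_of_mem (h1 i hi)
        · have hne : i' ≠ t := by rintro rfl; simp at h
          rw [Function.update_of_ne hne] at h
          have := ht i' (h1 i' (by simp [h]))
          rw [Function.update_of_ne (by omega)]
          exact h2 i i' hii h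
  rw [hsplit, sum_union, sum_union, sum_singleton, sum_image]
  · intro c hc d hd h
    funext i
    by_cases hi : i = t
    · subst hi
      rw [eq_empty_of_mem_columns hc htF, eq_empty_of_mem_columns hd htF]
    · simpa [Function.update_of_ne hi] using congrFun h i
  · rw [disjoint_singleton_right]
    intro h
    exact htF ((mem_columns.1 h).1 t (by simp [alphaColumn]))
  · rw [disjoint_left]
    intro c hc hc'
    obtain ⟨d, -, rfl⟩ := mem_image.1 hc'
    rcases mem_union.1 hc with h | h
    · exact htF ((mem_columns.1 h).1 t (by simp))
    · have := congrFun (mem_singleton.1 h) t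
      simp [alphaColumn] at this

/-- The number of occurrences of a symbol in a column. -/
noncomputable def columnCount (s : StairSymb) (c : ℕ → StairSymb) : ℕ := Set.ncard {i | c i = s}

/-- The weight of a column. -/
noncomputable def columnWt (α β : ℝ) (c : ℕ → StairSymb) : ℝ :=
  α ^ columnCount alpha c * β ^ columnCount beta c

open Classical in
/-- The rows in `F` where the column does not contain `beta`. -/
noncomputable def keptRows (F : Finset ℕ) (c : ℕ → StairSymb) : Finset ℕ :=
  F.filter fun i => c i ≠ beta

theorem columnWt_alphaColumn (α β : ℝ) (t : ℕ) : columnWt α β (alphaColumn t) = α := by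
  have ha : {i | alphaColumn t i = alpha} = {t} := by
    ext i; by_cases h : i = t <;> simp [alphaColumn, Function.update_apply, h]
  have hb : {i | alphaColumn t i = beta} = ∅ := by
    ext i; by_cases h : i = t <;> simp [alphaColumn, Function.update_apply, h]
  simp [columnWt, columnCount, ha, hb]

theorem columnWt_update (α β : ℝ) {F : Finset ℕ} {t : ℕ} (ht : t ∉ F) {c : ℕ → StairSymb}
    (hc : c ∈ columns F) :
    columnWt α β (Function.update c t beta) = β * columnWt α β c := by
  have hct := eq_empty_of_mem_columns hc ht
  have ha : {i | Function.update c t beta i = alpha} = {i | c i = alpha} := by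
    ext i; by_cases h : i = t <;> simp [Function.update_apply, h, hct]
  have hb : {i | Function.update c t beta i = beta} = insert t {i | c i = beta} := by
    ext i; by_cases h : i = t <;> simp [Function.update_apply, h]
  have hfin : {i | c i = beta}.Finite := F.finite_toSet.subset fun i (hi : c i = beta) =>
    (mem_columns.1 hc).1 i (by simp [hi])
  rw [columnWt, columnWt, columnCount, columnCount, ha, hb,
    Set.ncard_insert_of_notMem (by simp [hct]) hfin, columnCount, columnCount]
  ring

theorem keptRows_alphaColumn (F : Finset ℕ) (t : ℕ) : keptRows F (alphaColumn t) = F := by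
  refine filter_true_of_mem fun i _ => ?_
  by_cases h : i = t <;> simp [alphaColumn, h]

theorem keptRows_insert_update {F : Finset ℕ} {t : ℕ} (ht : t ∉ F) (c : ℕ → StairSymb) :
    keptRows (insert t F) (Function.update c t beta) = keptRows F c := by
  ext i
  by_cases h : i = t <;> simp [keptRows, Function.update_apply, h, ht]

theorem keptRows_insert {F : Finset ℕ} {t : ℕ} {c : ℕ → StairSymb}
    (hc : c t ≠ beta) : keptRows (insert t F) c = insert t (keptRows F c) := by
  ext i
  by_cases h : i = t <;> simp [keptRows, h, hc]

theorem notMem_keptRows {F : Finset ℕ} {t : ℕ} (ht : t ∉ F) (c : ℕ → StairSymb) :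
    t ∉ keptRows F c := fun h => ht (filter_subset _ _ h)

theorem sum_columns (α β x : ℝ) (F : Finset ℕ) :
    β * ∑ c ∈ columns F, columnWt α β c * x ^ #(keptRows F c) + α * x * x ^ #F =
      (α * x + β) * (x + β) ^ #F := by
  classical
  induction F using Finset.induction_on_max with
  | empty =>
    have : columns ∅ = {fun _ => empty} := by
      ext c
      rw [mem_columns, mem_singleton]
      constructor
      · rintro ⟨h, -⟩; funext i; simpa using h i
      · rintro rfl; simp
    simp [this, columnWt, columnCount, keptRows]
    ring
  | insert t F ht ih =>
    have htF : t ∉ F := fun h => lt_irrefl _ (ht t h)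
    rw [sum_columns_insert ht, columnWt_alphaColumn, keptRows_alphaColumn,
      card_insert_of_notMem htF]
    have h1 : ∑ c ∈ columns F, columnWt α β c * x ^ #(keptRows (insert t F) c) =
        x * ∑ c ∈ columns F, columnWt α β c * x ^ #(keptRows F c) := by
      rw [mul_sum]
      refine sum_congr rfl fun c hc => ?_
      rw [keptRows_insert (by simp [eq_empty_of_mem_columns hc htF]),
        card_insert_of_notMem (notMem_keptRows htF c)]
      ring
    have h2 : ∑ c ∈ columns F, columnWt α β (Function.update c t beta) *
        x ^ #(keptRows (insert t F) (Function.update c t beta)) =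
        β * ∑ c ∈ columns F, columnWt α β c * x ^ #(keptRows F c) := by
      rw [mul_sum]
      refine sum_congr rfl fun c hc => ?_
      rw [keptRows_insert_update htF, columnWt_update α β htF hc]
      ring
    rw [h1, h2]
    linear_combination (x + β) * ih

open Classical in
/-- Fillings of a column supported on `insert t F` whose box in row `t` is nonempty. -/
noncomputable def bottomedColumns (t : ℕ) (F : Finset ℕ) : Finset (ℕ → StairSymb) :=
  (columns (insert t F)).filter fun c => c t ≠ empty

theorem sum_bottomedColumns {F : Finset ℕ} {t : ℕ} (ht : ∀ i ∈ F, i < t)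
    (w : (ℕ → StairSymb) → ℝ) :
    ∑ c ∈ bottomedColumns t F, w c =
      w (alphaColumn t) + ∑ c ∈ columns F, w (Function.update c t beta) := by
  classical
  have htF : t ∉ F := fun h => lt_irrefl _ (ht t h)
  rw [bottomedColumns, sum_filter, sum_columns_insert ht, sum_eq_zero, zero_add]
  · simp [alphaColumn]
  · intro c hc
    simp [eq_empty_of_mem_columns hc htF]

theorem sum_bottomedColumns_wt (α β x : ℝ) {F : Finset ℕ} {t : ℕ} (ht : ∀ i ∈ F, i < t) :
    ∑ c ∈ bottomedColumns t F, columnWt α β c * x ^ #(keptRows (insert t F) c) =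
      (α * x + β) * (x + β) ^ #F := by
  have htF : t ∉ F := fun h => lt_irrefl _ (ht t h)
  rw [sum_bottomedColumns ht, ← sum_columns, columnWt_alphaColumn, keptRows_alphaColumn,
    card_insert_of_notMem htF, mul_sum, add_comm]
  congr 1
  · refine sum_congr rfl fun c hc => ?_
    rw [keptRows_insert_update htF, columnWt_update α β htF hc]
    ring
  · ring

open Classical in
theorem sum_bottomedColumns_second (α β x : ℝ) {F : Finset ℕ} {t : ℕ}
    (ht : ∀ i ∈ F, i < t + 1) :
    (∑ c ∈ bottomedColumns (t + 1) F, if c t ≠ empty then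
        columnWt α β c * x ^ #(keptRows (insert (t + 1) F) c) else 0) =
      if t ∈ F then β * ((α * x + β) * (x + β) ^ #(F.erase t)) else 0 := by
  have htF : t + 1 ∉ F := fun h => lt_irrefl _ (ht _ h)
  rw [sum_bottomedColumns ht, if_neg (by simp [alphaColumn]), zero_add]
  have hupd : ∀ c : ℕ → StairSymb, Function.update c (t + 1) beta t = c t := fun c =>
    Function.update_of_ne (by omega) _ _
  simp only [hupd]
  split_ifs with h
  · have hF : insert t (F.erase t) = F := insert_erase h
    have hlt : ∀ i ∈ F.erase t, i < t := fun i hi => by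
      have h1 := ht i (mem_of_mem_erase hi)
      have h2 := ne_of_mem_erase hi
      omega
    rw [← sum_bottomedColumns_wt α β x hlt, hF, bottomedColumns, hF, sum_filter, mul_sum]
    refine sum_congr rfl fun c hc => ?_
    rw [keptRows_insert_update htF, columnWt_update α β htF hc, mul_ite, mul_zero]
    simp only [mul_assoc]
  · refine sum_eq_zero fun c hc => ?_
    simp [eq_empty_of_mem_columns hc h]

/-! ### Adding a first column to a tableau -/

theorem finite_setOf_isStaircase (n : ℕ) : {S | IsStaircase n S}.Finite := by
  refine Set.Finite.of_finite_image
    (f := fun S => fun p : Fin (n + 1) × Fin (n + 1) => S p.1 p.2) (Set.toFinite _) ?_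
  intro S hS T hT h
  funext i j
  by_cases hij : 1 ≤ i ∧ 1 ≤ j ∧ i + j ≤ n + 1
  · exact congrFun h (⟨i, by omega⟩, ⟨j, by omega⟩)
  · rw [hS.1 i j hij, hT.1 i j hij]

/-- The finite set of staircase tableaux of size `n`. -/
noncomputable def staircases (n : ℕ) : Finset (ℕ → ℕ → StairSymb) :=
  (finite_setOf_isStaircase n).toFinset

theorem mem_staircases {n : ℕ} {S : ℕ → ℕ → StairSymb} : S ∈ staircases n ↔ IsStaircase n S := by
  simp [staircases]

/-- The filling with first column `c` followed by the columns of `T`. -/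
def consColumn (c : ℕ → StairSymb) (T : ℕ → ℕ → StairSymb) : ℕ → ℕ → StairSymb
  | _, 0 => empty
  | i, 1 => c i
  | i, j + 2 => T i (j + 1)

/-- The filling obtained by removing the first column. -/
def tailColumns (S : ℕ → ℕ → StairSymb) : ℕ → ℕ → StairSymb
  | _, 0 => empty
  | i, j + 1 => S i (j + 2)

open Classical in
/-- The rows of a tableau of size `n` not containing `beta`. -/
noncomputable def betaFreeRows (n : ℕ) (T : ℕ → ℕ → StairSymb) : Finset ℕ :=
  (Finset.Icc 1 n).filter fun i => ∀ j, T i j ≠ beta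

theorem mem_betaFreeRows {n : ℕ} {T : ℕ → ℕ → StairSymb} {i : ℕ} :
    i ∈ betaFreeRows n T ↔ (1 ≤ i ∧ i ≤ n) ∧ ∀ j, T i j ≠ beta := by
  simp [betaFreeRows]

theorem lt_of_mem_betaFreeRows {n : ℕ} {T : ℕ → ℕ → StairSymb} {i : ℕ}
    (h : i ∈ betaFreeRows n T) : i < n + 1 :=
  Nat.lt_succ_of_le (mem_betaFreeRows.1 h).1.2

theorem isStaircase_consColumn {n : ℕ} {T : ℕ → ℕ → StairSymb} (hT : IsStaircase n T)
    {c : ℕ → StairSymb} (hc : c ∈ bottomedColumns (n + 1) (betaFreeRows n T)) :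
    IsStaircase (n + 1) (consColumn c T) := by
  obtain ⟨hc, hn⟩ := mem_filter.1 hc
  obtain ⟨h1, h2⟩ := mem_columns.1 hc
  obtain ⟨t1, t2, t3, t4⟩ := hT
  have hrange : ∀ i, c i ≠ empty → 1 ≤ i ∧ i ≤ n + 1 := fun i hi => by
    rcases mem_insert.1 (h1 i hi) with h | h
    · omega
    · have := (mem_betaFreeRows.1 h).1; omega
  refine ⟨?_, ?_, ?_, ?_⟩
  · rintro i (_ | _ | j) h
    · rfl
    · by_contra hi
      have := hrange i hi
      omega
    · exact t1 i (j + 1) (by omega)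
  · rintro i i' (_ | _ | j) hi hii hj hn' h
    · rfl
    · exact h2 i i' hii h
    · exact t2 i i' (j + 1) hi hii (by omega) (by omega) h
  · rintro i (_ | _ | j) (_ | _ | j') hi hj hjj hn' h
    any_goals first | rfl | omega
    · by_contra hne
      rcases mem_insert.1 (h1 i hne) with h' | h'
      · omega
      · exact (mem_betaFreeRows.1 h').2 (j' + 1) h
    · exact t3 i (j + 1) (j' + 1) hi (by omega) (by omega) (by omega) h
  · rintro i (_ | _ | j) hi hj hij
    · omega
    · obtain rfl : i = n + 1 := by omega
      exact hn
    · exact t4 i (j + 1) hi (by omega) (by omega)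

theorem isStaircase_tailColumns {n : ℕ} {S : ℕ → ℕ → StairSymb} (hS : IsStaircase (n + 1) S) :
    IsStaircase n (tailColumns S) := by
  obtain ⟨t1, t2, t3, t4⟩ := hS
  refine ⟨?_, ?_, ?_, ?_⟩
  · rintro i (_ | j) h
    · rfl
    · exact t1 i (j + 2) (by omega)
  · rintro i i' (_ | j) hi hii hj hn h
    · rfl
    · exact t2 i i' (j + 2) hi hii (by omega) (by omega) h
  · rintro i (_ | j) (_ | j') hi hj hjj hn h
    any_goals first | rfl | omega
    exact t3 i (j + 2) (j' + 2) hi (by omega) (by omega) (by omega) h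
  · rintro i (_ | j) hi hj hij
    · omega
    · exact t4 i (j + 2) hi (by omega) (by omega)

theorem firstColumn_mem {n : ℕ} {S : ℕ → ℕ → StairSymb} (hS : IsStaircase (n + 1) S) :
    (fun i => S i 1) ∈ bottomedColumns (n + 1) (betaFreeRows n (tailColumns S)) := by
  have htail := isStaircase_tailColumns hS
  obtain ⟨t1, t2, t3, t4⟩ := hS
  have hrange : ∀ i j, S i j ≠ empty → 1 ≤ i ∧ 1 ≤ j ∧ i + j ≤ n + 1 + 1 := fun i j hi => by
    by_contra h; exact hi (t1 i j h)
  refine mem_filter.2 ⟨mem_columns.2 ⟨fun i hi => ?_, fun i i' hii h => ?_⟩,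
    t4 (n + 1) 1 (by omega) le_rfl rfl⟩
  · have hr := hrange i 1 hi
    by_cases hin : i = n + 1
    · simp [hin]
    · refine mem_insert_of_mem (mem_betaFreeRows.2 ⟨by omega, ?_⟩)
      rintro (_ | j) hb
      · simp [tailColumns] at hb
      · change S i (j + 2) = beta at hb
        have := hrange i (j + 2) (by simp [hb])
        exact hi (t3 i 1 (j + 2) hr.1 le_rfl (by omega) (by omega) hb)
  · by_contra hne
    have h1 := hrange i 1 hne
    have h2 := hrange i' 1 (by simp [h])
    exact hne (t2 i i' 1 h1.1 hii le_rfl (by omega) h)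

theorem sum_staircases_succ (n : ℕ) (g : (ℕ → ℕ → StairSymb) → ℝ) :
    ∑ S ∈ staircases (n + 1), g S =
      ∑ T ∈ staircases n, ∑ c ∈ bottomedColumns (n + 1) (betaFreeRows n T),
        g (consColumn c T) := by
  rw [sum_sigma']
  symm
  refine sum_nbij' (fun p => consColumn p.2 p.1)
    (fun S => ⟨tailColumns S, fun i => S i 1⟩) ?_ ?_ ?_ ?_ (fun _ _ => rfl)
  · rintro ⟨T, c⟩ h
    obtain ⟨hT, hc⟩ := mem_sigma.1 h
    exact mem_staircases.2 (isStaircase_consColumn (mem_staircases.1 hT) hc)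
  · intro S hS
    have hS := mem_staircases.1 hS
    exact mem_sigma.2 ⟨mem_staircases.2 (isStaircase_tailColumns hS), firstColumn_mem hS⟩
  · rintro ⟨T, c⟩ h
    have hT := mem_staircases.1 (mem_sigma.1 h).1
    refine Sigma.ext ?_ (heq_of_eq rfl)
    funext i j
    rcases j with _ | j
    · exact (hT.1 i 0 (by omega)).symm
    · rfl
  · intro S hS
    have hS := mem_staircases.1 hS
    funext i j
    rcases j with _ | _ | j
    · exact (hS.1 i 0 (by omega)).symm
    · rfl
    · rfl

theorem ncard_consColumn {n : ℕ} {T : ℕ → ℕ → StairSymb} (hT : IsStaircase n T)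
    {F : Finset ℕ} {c : ℕ → StairSymb} (hc : c ∈ columns F) {s : StairSymb} (hs : s ≠ empty) :
    Set.ncard {p : ℕ × ℕ | consColumn c T p.1 p.2 = s} =
      columnCount s c + Set.ncard {p : ℕ × ℕ | T p.1 p.2 = s} := by
  have hsplit : {p : ℕ × ℕ | consColumn c T p.1 p.2 = s} =
      (fun i => (i, 1)) '' {i | c i = s} ∪
        (fun p : ℕ × ℕ => (p.1, p.2 + 1)) '' {p : ℕ × ℕ | T p.1 p.2 = s} := by
    ext ⟨i, j⟩
    have h0 : ∀ i, T i 0 = empty := fun i => hT.1 i 0 (by omega)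
    rcases j with _ | _ | j
    · simp [consColumn, hs.symm]
    · simp [consColumn, h0, hs.symm]
    · simp [consColumn]
  have hfc : {i | c i = s}.Finite := F.finite_toSet.subset fun i (hi : c i = s) =>
    (mem_columns.1 hc).1 i (hi ▸ hs)
  have hfT : {p : ℕ × ℕ | T p.1 p.2 = s}.Finite := by
    refine ((Set.finite_Iic (n + 1)).prod (Set.finite_Iic (n + 1))).subset ?_
    rintro ⟨i, j⟩ (h : T i j = s)
    by_contra hij
    refine hs (h.symm.trans (hT.1 i j fun h' => hij ?_))
    simp only [Set.mem_prod, Set.mem_Iic]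
    omega
  rw [hsplit, Set.ncard_union_eq ?_ (hfc.image _) (hfT.image _),
    Set.ncard_image_of_injective _ fun a b h => by simpa using h,
    Set.ncard_image_of_injective _ fun a b h => by simpa [Prod.ext_iff] using h, columnCount]
  rw [Set.disjoint_left]
  rintro _ ⟨i, -, rfl⟩ ⟨⟨i', j⟩, h, h'⟩
  obtain rfl : j = 0 := by simpa using congrArg Prod.snd h'
  exact hs (h.symm.trans (hT.1 i' 0 (by simp)))

theorem stairWt_consColumn (α β : ℝ) {n : ℕ} {T : ℕ → ℕ → StairSymb} (hT : IsStaircase n T)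
    {t : ℕ} {F : Finset ℕ} {c : ℕ → StairSymb} (hc : c ∈ bottomedColumns t F) :
    stairWt α β (consColumn c T) = stairWt α β T * columnWt α β c := by
  have hc := (mem_filter.1 hc).1
  rw [stairWt, stairWt, columnWt, ncard_consColumn hT hc (by simp),
    ncard_consColumn hT hc (by simp)]
  ring

theorem betaFreeRows_consColumn {n : ℕ} {T : ℕ → ℕ → StairSymb} (hT : IsStaircase n T)
    (c : ℕ → StairSymb) :
    betaFreeRows (n + 1) (consColumn c T) = keptRows (insert (n + 1) (betaFreeRows n T)) c := by
  ext i
  simp only [mem_betaFreeRows, keptRows, mem_filter, mem_insert]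
  constructor
  · rintro ⟨hi, h⟩
    refine ⟨?_, h 1⟩
    by_cases hin : i = n + 1
    · exact Or.inl hin
    · refine Or.inr ⟨by omega, ?_⟩
      rintro (_ | j)
      · rw [hT.1 i 0 (by omega)]; simp
      · exact h (j + 2)
  · rintro ⟨hi, h⟩
    refine ⟨by omega, ?_⟩
    rintro (_ | _ | j)
    · simp [consColumn]
    · exact h
    · rcases hi with rfl | hi
      · simp [consColumn, hT.1 (n + 1) (j + 1) (by omega)]
      · exact hi.2 (j + 1)

/-! ### Weighted enumeration of tableaux with prescribed nonempty boxes -/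

/-- The boxes of the second main diagonal in the columns `J` are nonempty. -/
def SecondDiagNonempty (n : ℕ) (J : Finset ℕ) (S : ℕ → ℕ → StairSymb) : Prop :=
  ∀ j ∈ J, S (n - j) j ≠ empty

/-- The finset obtained by adding one to all elements. -/
def shiftSucc (K : Finset ℕ) : Finset ℕ := K.map ⟨Nat.succ, Nat.succ_injective⟩

theorem mem_shiftSucc {K : Finset ℕ} {j : ℕ} : j ∈ shiftSucc K ↔ ∃ k ∈ K, k + 1 = j := by
  simp [shiftSucc]

theorem secondDiagNonempty_shiftSucc {n : ℕ} {K : Finset ℕ} (hK : ∀ k ∈ K, 1 ≤ k)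
    (c : ℕ → StairSymb) (T : ℕ → ℕ → StairSymb) :
    SecondDiagNonempty (n + 1) (shiftSucc K) (consColumn c T) ↔ SecondDiagNonempty n K T := by
  have key : ∀ k ∈ K, consColumn c T (n + 1 - (k + 1)) (k + 1) = T (n - k) k := fun k hk => by
    obtain ⟨m, rfl⟩ := Nat.exists_eq_add_of_le' (hK k hk)
    rw [Nat.add_sub_add_right]
    rfl
  constructor
  · intro h k hk
    rw [← key k hk]
    exact h (k + 1) (mem_shiftSucc.2 ⟨k, hk, rfl⟩)
  · intro h j hj
    obtain ⟨k, hk, rfl⟩ := mem_shiftSucc.1 hj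
    rw [key k hk]
    exact h k hk

theorem secondDiagNonempty_insert_one {n : ℕ} {K : Finset ℕ} (hK : ∀ k ∈ K, 1 ≤ k)
    (c : ℕ → StairSymb) (T : ℕ → ℕ → StairSymb) :
    SecondDiagNonempty (n + 1) (insert 1 (shiftSucc K)) (consColumn c T) ↔
      SecondDiagNonempty n K T ∧ c n ≠ empty := by
  rw [← secondDiagNonempty_shiftSucc hK c T, SecondDiagNonempty, forall_mem_insert, and_comm]
  rfl

open Classical in
/-- The weighted sum over tableaux whose boxes on the second main diagonal in the columns `J` are
nonempty, with an additional factor `x` for each row without `beta`. -/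
noncomputable def restrictedZ (α β : ℝ) (n : ℕ) (J : Finset ℕ) (x : ℝ) : ℝ :=
  ∑ S ∈ staircases n,
    if SecondDiagNonempty n J S then stairWt α β S * x ^ #(betaFreeRows n S) else 0

theorem restrictedZ_shiftSucc (α β : ℝ) (n : ℕ) {K : Finset ℕ} (hK : ∀ k ∈ K, 1 ≤ k) (x : ℝ) :
    restrictedZ α β (n + 1) (shiftSucc K) x = (α * x + β) * restrictedZ α β n K (x + β) := by
  classical
  rw [restrictedZ, restrictedZ, sum_staircases_succ, mul_sum]
  refine sum_congr rfl fun T hT => ?_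
  have hT := mem_staircases.1 hT
  simp only [secondDiagNonempty_shiftSucc hK]
  split_ifs
  · rw [mul_left_comm, ← sum_bottomedColumns_wt α β x fun i => lt_of_mem_betaFreeRows, mul_sum]
    refine sum_congr rfl fun c hc => ?_
    rw [stairWt_consColumn α β hT hc, betaFreeRows_consColumn hT, mul_assoc]
  · simp

theorem restrictedZ_insert_one (α β : ℝ) (n : ℕ) {K : Finset ℕ} (hK : ∀ k ∈ K, 1 ≤ k) (x : ℝ) :
    restrictedZ α β (n + 2) (insert 1 (shiftSucc (shiftSucc K))) x =
      α * β * restrictedZ α β (n + 1) (shiftSucc K) x := by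
  classical
  have hK' : ∀ k ∈ shiftSucc K, 1 ≤ k := fun k hk => by
    obtain ⟨m, -, rfl⟩ := mem_shiftSucc.1 hk
    omega
  have hfirst : restrictedZ α β (n + 2) (insert 1 (shiftSucc (shiftSucc K))) x =
      ∑ T ∈ staircases (n + 1), if SecondDiagNonempty (n + 1) (shiftSucc K) T then
        stairWt α β T * (if n + 1 ∈ betaFreeRows (n + 1) T then
          β * ((α * x + β) * (x + β) ^ #((betaFreeRows (n + 1) T).erase (n + 1))) else 0)
        else 0 := by
    rw [restrictedZ, sum_staircases_succ]
    refine sum_congr rfl fun T hT => ?_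
    have hT := mem_staircases.1 hT
    simp only [secondDiagNonempty_insert_one hK', ite_and]
    by_cases h : SecondDiagNonempty (n + 1) (shiftSucc K) T
    · simp only [h, if_true]
      rw [← sum_bottomedColumns_second α β x fun i => lt_of_mem_betaFreeRows, mul_sum]
      refine sum_congr rfl fun c hc => ?_
      rw [stairWt_consColumn α β hT hc, betaFreeRows_consColumn hT, mul_ite, mul_zero, mul_assoc]
    · simp [h]
  rw [hfirst, restrictedZ_shiftSucc α β n hK, restrictedZ, sum_staircases_succ, mul_sum, mul_sum]
  refine sum_congr rfl fun T hT => ?_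
  have hT := mem_staircases.1 hT
  have hlt : ∀ i ∈ betaFreeRows n T, i < n + 1 := fun i => lt_of_mem_betaFreeRows
  have hn : n + 1 ∉ betaFreeRows n T := fun h => lt_irrefl _ (hlt _ h)
  simp only [secondDiagNonempty_shiftSucc hK, betaFreeRows_consColumn hT]
  split_ifs
  · have hsum : ∀ c ∈ bottomedColumns (n + 1) (betaFreeRows n T),
        stairWt α β (consColumn c T) = stairWt α β T * columnWt α β c := fun c hc =>
      stairWt_consColumn α β hT hc
    rw [sum_congr rfl fun c hc => by rw [hsum c hc], sum_bottomedColumns hlt, sum_eq_zero,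
      add_zero, keptRows_alphaColumn, columnWt_alphaColumn, if_pos (mem_insert_self _ _),
      erase_insert hn]
    · ring
    · intro c _
      rw [keptRows_insert_update hn, if_neg (notMem_keptRows hn c), mul_zero]
  · simp

theorem restrictedZ_zero (α β x : ℝ) : restrictedZ α β 0 ∅ x = 1 := by
  have : staircases 0 = {fun _ _ => empty} := by
    ext S
    rw [mem_staircases, mem_singleton]
    constructor
    · intro h
      funext i j
      exact h.1 i j (by omega)
    · rintro rfl
      exact ⟨fun _ _ _ => rfl, fun _ _ _ _ _ _ _ _ => rfl, fun _ _ _ _ _ _ _ _ => rfl,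
        fun _ _ _ _ _ => by omega⟩
  simp [restrictedZ, this, SecondDiagNonempty, stairWt, betaFreeRows]

theorem exists_eq_shiftSucc {J : Finset ℕ} (h : 0 ∉ J) : ∃ K, J = shiftSucc K := by
  refine ⟨J.image Nat.pred, ?_⟩
  ext j
  simp only [mem_shiftSucc, mem_image]
  constructor
  · intro hj
    have : j ≠ 0 := fun h0 => h (h0 ▸ hj)
    exact ⟨j - 1, ⟨j, hj, rfl⟩, by omega⟩
  · rintro ⟨_, ⟨i, hi, rfl⟩, rfl⟩
    have : i ≠ 0 := fun h0 => h (h0 ▸ hi)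
    rwa [Nat.pred_eq_sub_one, Nat.sub_add_cancel (by omega)]

theorem card_shiftSucc (K : Finset ℕ) : #(shiftSucc K) = #K := card_map _

theorem restrictedZ_eq (α β : ℝ) (n : ℕ) (J : Finset ℕ) (x : ℝ) (hJ : ∀ j ∈ J, 1 ≤ j ∧ j + 1 ≤ n)
    (hgap : ∀ j ∈ J, j + 1 ∉ J) :
    restrictedZ α β n J x = (α * β) ^ #J * ∏ i ∈ range (n - #J), (α * (x + i * β) + β) := by
  induction n using Nat.strong_induction_on generalizing J x with
  | _ n ih =>
  rcases n with _ | n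
  · obtain rfl : J = ∅ := eq_empty_of_forall_notMem fun j hj => by have := hJ j hj; omega
    simp [restrictedZ_zero]
  obtain ⟨K, rfl⟩ := exists_eq_shiftSucc (J := J) fun h => by have := hJ 0 h; omega
  have hmem : ∀ {k}, k ∈ K → k + 1 ∈ shiftSucc K := fun h => mem_shiftSucc.2 ⟨_, h, rfl⟩
  have hKn : ∀ k ∈ K, k + 1 ≤ n := fun k hk => by have := hJ _ (hmem hk); omega
  by_cases h0 : 0 ∈ K
  · obtain ⟨m, rfl⟩ : ∃ m, n = m + 1 := Nat.exists_eq_add_of_le' (hKn 0 h0)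
    obtain ⟨L, hL⟩ := exists_eq_shiftSucc (J := K.erase 0) (by simp)
    have hLK : ∀ {k}, k ∈ L → k + 1 ∈ K := fun h => mem_of_mem_erase (a := 0)
      (hL ▸ mem_shiftSucc.2 ⟨_, h, rfl⟩)
    have hL1 : ∀ k ∈ L, 1 ≤ k := fun k hk => Nat.one_le_iff_ne_zero.2 fun h =>
      hgap 1 (hmem h0) (hmem (hLK (h ▸ hk)))
    have hK : K = insert 0 (shiftSucc L) := by rw [← hL, insert_erase h0]
    have hdec : shiftSucc K = insert 1 (shiftSucc (shiftSucc L)) := by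
      rw [hK]
      simp [shiftSucc]
    have hcard : #(shiftSucc K) = #L + 1 := by
      rw [card_shiftSucc, hK, card_insert_of_notMem (by simp [mem_shiftSucc]), card_shiftSucc]
    rw [hcard, hdec, restrictedZ_insert_one α β m hL1, ih (m + 1) (by omega) (shiftSucc L) x,
      card_shiftSucc, Nat.add_sub_add_right]
    · ring
    · intro j hj
      obtain ⟨l, hl, rfl⟩ := mem_shiftSucc.1 hj
      have := hKn _ (hLK hl)
      omega
    · intro j hj hj'
      obtain ⟨l, hl, rfl⟩ := mem_shiftSucc.1 hj
      obtain ⟨l', hl', h⟩ := mem_shiftSucc.1 hj'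
      obtain rfl : l' = l + 1 := by omega
      exact hgap _ (hmem (hLK hl)) (hmem (hLK hl'))
  · have hK1 : ∀ k ∈ K, 1 ≤ k := fun k hk =>
      Nat.one_le_iff_ne_zero.2 fun h => h0 (h ▸ hk)
    have hcard : #K ≤ n := by
      have := card_le_card (s := K) (t := range n) fun k hk => mem_range.2 (hKn k hk)
      simpa using this
    rw [restrictedZ_shiftSucc α β n hK1, ih n (by omega) K (x + β)
      (fun k hk => ⟨hK1 k hk, hKn k hk⟩) (fun k hk h => hgap _ (hmem hk) (hmem h)),
      card_shiftSucc, Nat.sub_add_comm hcard, prod_range_succ']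
    have : ∏ i ∈ range (n - #K), (α * (x + β + i * β) + β) =
        ∏ i ∈ range (n - #K), (α * (x + (i + 1 : ℕ) * β) + β) :=
      prod_congr rfl fun i _ => by push_cast; ring
    rw [this]
    push_cast
    ring

theorem finsum_isStaircase (α β : ℝ) (n : ℕ) (J : Finset ℕ)
    (E : (ℕ → ℕ → StairSymb) → Prop) (hE : ∀ S, E S ↔ SecondDiagNonempty n J S) :
    ∑ᶠ S ∈ {S : ℕ → ℕ → StairSymb | IsStaircase n S ∧ E S}, stairWt α β S =
      restrictedZ α β n J 1 := by
  classical
  rw [restrictedZ, ← sum_filter]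
  simp only [one_pow, mul_one]
  rw [← finsum_mem_finset_eq_sum]
  refine finsum_congr fun S => ?_
  simp [mem_staircases, hE]

theorem stairZ_eq (α β : ℝ) (n : ℕ) :
    stairZ n α β = ∏ i ∈ range n, (α + β + i * (α * β)) := by
  have h := finsum_isStaircase α β n ∅ (fun _ => True) (by simp [SecondDiagNonempty])
  simp only [and_true] at h
  rw [stairZ, h, restrictedZ_eq α β n ∅ 1 (by simp) (by simp)]
  simp only [card_empty, pow_zero, one_mul, Nat.sub_zero]
  exact prod_congr rfl fun i _ => by ring

theorem prod_range_sub_eq {α β : ℝ} (hα : 0 < α) (hβ : 0 < β) {n r : ℕ} (hr : r ≤ n) :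
    (α * β) ^ r * ∏ i ∈ range (n - r), (α + β + i * (α * β)) =
      (∏ i ∈ range n, (α + β + i * (α * β))) *
        ∏ l ∈ range r, 1 / ((n : ℝ) + 1 / α + 1 / β - (l + 1 : ℝ)) := by
  induction r with
  | zero => simp
  | succ r ih =>
    obtain ⟨m, rfl⟩ := Nat.exists_eq_add_of_le' hr
    have h1 : m + (r + 1) - r = m + 1 := by omega
    have h2 : ((m + (r + 1) : ℕ) : ℝ) + 1 / α + 1 / β - (r + 1 : ℝ) =
        (α + β + m * (α * β)) / (α * β) := by
      push_cast
      field_simp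
      ring
    have h3 : α + β + m * (α * β) ≠ 0 := by positivity
    rw [prod_range_succ _ r, ← mul_assoc, ← ih (by omega), h1, h2, Nat.add_sub_cancel,
      prod_range_succ]
    field_simp
    ring

/-- Joint distribution of nonempty boxes on the second main diagonal: if the columns
`j_1 < ⋯ < j_r` have consecutive gaps `≥ 2`, then the probability that each box
`(n − j_l, j_l)` is nonempty equals `∏_{l=1}^r 1/(n+a+b−l)`. -/
theorem nonempty_on_second_diagonal (n : ℕ) (hn : 1 ≤ n) (α β : ℝ) (hα : 0 < α) (hβ : 0 < β)
    (r : ℕ) (hr : 1 ≤ r) (j : Fin r → ℕ)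
    (hj1 : ∀ l, 1 ≤ j l) (hjn : ∀ l, j l ≤ n - 1) (hmono : StrictMono j)
    (hgap : ∀ l : Fin r, ∀ h : (l : ℕ) + 1 < r, j l + 2 ≤ j ⟨(l : ℕ) + 1, h⟩) :
    stairP n α β (fun S => ∀ l : Fin r, S (n - j l) (j l) ≠ StairSymb.empty)
      = ∏ l : Fin r, 1 / ((n : ℝ) + 1/α + 1/β - ((l : ℕ) + 1 : ℝ)) := by
  classical
  set J : Finset ℕ := univ.image j with hJ
  have hcard : #J = r := by rw [hJ, card_image_of_injective _ hmono.injective, card_fin]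
  have hJn : ∀ i ∈ J, 1 ≤ i ∧ i + 1 ≤ n := by
    intro i hi
    obtain ⟨l, -, rfl⟩ := mem_image.1 hi
    have h1 := hj1 l
    have h2 := hjn l
    omega
  have hJgap : ∀ i ∈ J, i + 1 ∉ J := by
    intro i hi hi'
    obtain ⟨l, -, rfl⟩ := mem_image.1 hi
    obtain ⟨k, -, hk⟩ := mem_image.1 hi'
    have hlk : l < k := hmono.lt_iff_lt.1 (by omega)
    have hl : (l : ℕ) + 1 < r := by have := k.2; omega
    have h1 := hgap l hl
    have h2 : j ⟨(l : ℕ) + 1, hl⟩ ≤ j k := hmono.monotone (Fin.le_def.2 hlk)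
    omega
  have hrn : r ≤ n := by
    have := card_le_card (s := J) (t := range n) fun i hi => mem_range.2 (hJn i hi).2
    rwa [hcard, card_range] at this
  have hZ : (∏ i ∈ range n, (α + β + i * (α * β))) ≠ 0 :=
    prod_ne_zero_iff.2 fun i _ => by positivity
  rw [stairP, finsum_isStaircase α β n J _ (by simp [SecondDiagNonempty, hJ]), stairZ_eq,
    restrictedZ_eq α β n J 1 hJn hJgap, hcard, div_eq_iff hZ,
    Fin.prod_univ_eq_prod_range (fun l : ℕ => 1 / ((n : ℝ) + 1 / α + 1 / β - (l + 1 : ℝ))) r,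
    mul_comm (∏ l ∈ range r, _), ← prod_range_sub_eq hα hβ hrn]
  exact congrArg _ (prod_congr rfl fun i _ => by ring)
end
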